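/- arXiv:2107.14477 — 2 statements merged into one kernel-verified Lean document; each statement's English description precedes it below -/
import Mathlib

section
/- Let a, b, c ∈ F and let d ≥ 1 be an odd integer. Then the 𝔥-module E_d(a,b,c) is irreducible if and only if none of a+b+c, −a+b+c, a−b+c, a+b−c belongs to the set {(d−1)/2 − i : i = 0, 2, …, d−1}. -/
open FreeAlgebra

noncomputable section

variable (F : Type) [Field F]

/-! ## The universal Racah algebra -/

/-- `α = [A,D] + AC - BA` in the free algebra on `A,B,C,D`. -/
def alphaFree : FreeAlgebra F (Fin 4) :=
  ι F 0 * ι F 3 - ι F 3 * ι F 0 + ι F 0 * ι F 2 - ι F 1 * ι F 0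

/-- `β = [B,D] + BA - CB` in the free algebra on `A,B,C,D`. -/
def betaFree : FreeAlgebra F (Fin 4) :=
  ι F 1 * ι F 3 - ι F 3 * ι F 1 + ι F 1 * ι F 0 - ι F 2 * ι F 1

/-- `γ = [C,D] + CB - AC` in the free algebra on `A,B,C,D`. -/
def gammaFree : FreeAlgebra F (Fin 4) :=
  ι F 2 * ι F 3 - ι F 3 * ι F 2 + ι F 2 * ι F 1 - ι F 0 * ι F 2

/-- The defining relations of the universal Racah algebra:
`[A,B] = [B,C] = [C,A] = 2D` and `α`, `β`, `γ` commute with the generators. -/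
inductive RacahRel : FreeAlgebra F (Fin 4) → FreeAlgebra F (Fin 4) → Prop
  | AB : RacahRel (ι F 0 * ι F 1 - ι F 1 * ι F 0) (2 * ι F 3)
  | BC : RacahRel (ι F 1 * ι F 2 - ι F 2 * ι F 1) (2 * ι F 3)
  | CA : RacahRel (ι F 2 * ι F 0 - ι F 0 * ι F 2) (2 * ι F 3)
  | alphaC (i : Fin 4) : RacahRel (alphaFree F * ι F i) (ι F i * alphaFree F)
  | betaC (i : Fin 4) : RacahRel (betaFree F * ι F i) (ι F i * betaFree F)
  | gammaC (i : Fin 4) : RacahRel (gammaFree F * ι F i) (ι F i * gammaFree F)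

/-- The universal Racah algebra `ℜ`. -/
abbrev RacahAlg := RingQuot (RacahRel F)

def rA : RacahAlg F := RingQuot.mkAlgHom F (RacahRel F) (ι F 0)
def rB : RacahAlg F := RingQuot.mkAlgHom F (RacahRel F) (ι F 1)
def rC : RacahAlg F := RingQuot.mkAlgHom F (RacahRel F) (ι F 2)
def rD : RacahAlg F := RingQuot.mkAlgHom F (RacahRel F) (ι F 3)
def rDelta : RacahAlg F := rA F + rB F + rC F
def rAlpha : RacahAlg F := RingQuot.mkAlgHom F (RacahRel F) (alphaFree F)
def rBeta : RacahAlg F := RingQuot.mkAlgHom F (RacahRel F) (betaFree F)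
def rGamma : RacahAlg F := RingQuot.mkAlgHom F (RacahRel F) (gammaFree F)

/-! ## The universal additive DAHA of type `(C₁∨, C₁)` -/

/-- The defining relations: `t₀ + t₁ + t₂ + t₃ = -1` and each `tᵢ²` is central. -/
inductive DAHARel : FreeAlgebra F (Fin 4) → FreeAlgebra F (Fin 4) → Prop
  | sum : DAHARel (ι F 0 + ι F 1 + ι F 2 + ι F 3) (-1)
  | central (i j : Fin 4) : DAHARel (ι F i * ι F i * ι F j) (ι F j * (ι F i * ι F i))

/-- The universal additive DAHA `𝔥` of type `(C₁∨, C₁)`. -/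
abbrev DAHAAlg := RingQuot (DAHARel F)

/-- The generators `t₀, t₁, t₂, t₃` of `𝔥`. -/
def tGen (i : Fin 4) : DAHAAlg F := RingQuot.mkAlgHom F (DAHARel F) (ι F i)

/-! ## Scalar restriction along `algebraMap`, actions as `F`-linear operators -/

/-- The `F`-vector space structure on a module over an `F`-algebra `A`. -/
def resF (A : Type) [Ring A] [Algebra F A] (W : Type) [AddCommGroup W] [Module A W] :
    Module F W := Module.compHom W (algebraMap F A)

theorem resF_tower (A : Type) [Ring A] [Algebra F A] (W : Type) [AddCommGroup W] [Module A W]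
    [instF : Module F W] (h : instF = resF F A W) : IsScalarTower F A W := by
  have key : ∀ (a : F) (u : W), a • u = algebraMap F A a • u := by
    intro a u; rw [h]; rfl
  exact ⟨fun a x w => by rw [Algebra.smul_def, mul_smul, key a (x • w)]⟩

/-- The action of `x : A` on an `A`-module `W` as an `F`-linear operator. -/
def opOf {A : Type} [Ring A] [Algebra F A] (x : A) (W : Type) [AddCommGroup W] [Module F W]
    [Module A W] [IsScalarTower F A W] : Module.End F W where
  toFun w := x • w
  map_add' u v := smul_add x u v
  map_smul' a w := by
    simp only [RingHom.id_apply]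
    rw [← algebraMap_smul A a w, ← mul_smul, ← Algebra.commutes, mul_smul, algebraMap_smul]

/-- `x : A` acts diagonalizably on the `A`-module `W`. -/
def ActsDiagOn {A : Type} [Ring A] [Algebra F A] (x : A) (W : Type) [AddCommGroup W]
    [Module A W] : Prop :=
  letI := resF F A W
  haveI := resF_tower F A W rfl
  (⨆ μ : F, Module.End.eigenspace (opOf F x W) μ) = ⊤

/-- `x : A` acts on the `A`-module `W` in a multiplicity-free way: every eigenvalue of the
action of `x` has algebraic multiplicity one. -/
def ActsMultFreeOn {A : Type} [Ring A] [Algebra F A] (x : A) (W : Type) [AddCommGroup W]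
    [Module A W] : Prop :=
  letI := resF F A W
  haveI := resF_tower F A W rfl
  ∀ μ : F, Module.End.HasEigenvalue (opOf F x W) μ →
    Module.finrank F (Module.End.maxGenEigenspace (opOf F x W) μ) = 1

/-- `x : A` acts on the `A`-module `W` as scalar multiplication by `μ : F`. -/
def actsAsScalar {A : Type} [Ring A] [Algebra F A] (x : A) (μ : F) (W : Type)
    [AddCommGroup W] [Module A W] : Prop :=
  letI := resF F A W
  ∀ u : W, x • u = μ • u

/-- The trace of the action of `x : A` on the `A`-module `W`. -/
def traceOf {A : Type} [Ring A] [Algebra F A] (x : A) (W : Type) [AddCommGroup W]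
    [Module A W] : F :=
  letI := resF F A W
  haveI := resF_tower F A W rfl
  LinearMap.trace F W (opOf F x W)

/-! ## Tridiagonal matrices, Leonard pairs and Leonard triples -/

/-- A square matrix is tridiagonal if each nonzero entry lies on the diagonal, the
superdiagonal, or the subdiagonal. -/
def IsTridiag {n : ℕ} (M : Matrix (Fin n) (Fin n) F) : Prop :=
  ∀ i j : Fin n, M i j ≠ 0 → (i : ℕ) = (j : ℕ) ∨ (i : ℕ) = (j : ℕ) + 1 ∨ (j : ℕ) = (i : ℕ) + 1

/-- A tridiagonal matrix is irreducible if every superdiagonal and subdiagonal entry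
is nonzero. -/
def IsIrrTridiag {n : ℕ} (M : Matrix (Fin n) (Fin n) F) : Prop :=
  IsTridiag F M ∧ ∀ i j : Fin n, ((i : ℕ) = (j : ℕ) + 1 ∨ (j : ℕ) = (i : ℕ) + 1) → M i j ≠ 0

/-- `x, y : A` act on the `A`-module `W` as a Leonard pair. -/
def ActsAsLeonardPairOn {A : Type} [Ring A] [Algebra F A] (x y : A) (W : Type)
    [AddCommGroup W] [Module A W] : Prop :=
  letI := resF F A W
  haveI := resF_tower F A W rfl
  (∃ (n : ℕ) (b : Module.Basis (Fin n) F W),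
      (LinearMap.toMatrix b b (opOf F x W)).IsDiag ∧
      IsIrrTridiag F (LinearMap.toMatrix b b (opOf F y W))) ∧
  (∃ (n : ℕ) (b : Module.Basis (Fin n) F W),
      (LinearMap.toMatrix b b (opOf F y W)).IsDiag ∧
      IsIrrTridiag F (LinearMap.toMatrix b b (opOf F x W)))

/-- `x, y, z : A` act on the `A`-module `W` as a Leonard triple. -/
def ActsAsLeonardTripleOn {A : Type} [Ring A] [Algebra F A] (x y z : A) (W : Type)
    [AddCommGroup W] [Module A W] : Prop :=
  letI := resF F A W
  haveI := resF_tower F A W rfl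
  (∃ (n : ℕ) (b : Module.Basis (Fin n) F W),
      (LinearMap.toMatrix b b (opOf F x W)).IsDiag ∧
      IsIrrTridiag F (LinearMap.toMatrix b b (opOf F y W)) ∧
      IsIrrTridiag F (LinearMap.toMatrix b b (opOf F z W))) ∧
  (∃ (n : ℕ) (b : Module.Basis (Fin n) F W),
      (LinearMap.toMatrix b b (opOf F y W)).IsDiag ∧
      IsIrrTridiag F (LinearMap.toMatrix b b (opOf F z W)) ∧
      IsIrrTridiag F (LinearMap.toMatrix b b (opOf F x W))) ∧
  (∃ (n : ℕ) (b : Module.Basis (Fin n) F W),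
      (LinearMap.toMatrix b b (opOf F z W)).IsDiag ∧
      IsIrrTridiag F (LinearMap.toMatrix b b (opOf F x W)) ∧
      IsIrrTridiag F (LinearMap.toMatrix b b (opOf F y W)))

/-! ## The irreducible `ℜ`-modules `R_d(a,b,c)` -/

/-- `θᵢ = (x + d/2 - i)(x + d/2 - i + 1)`. -/
def thP (x : F) (d i : ℕ) : F := (x + (d : F) / 2 - (i : F)) * (x + (d : F) / 2 - (i : F) + 1)

/-- `φᵢ = i(i-d-1)(a+b+c+d/2-i+2)(a+b-c+d/2-i+1)`. -/
def phP (a b c : F) (d i : ℕ) : F :=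
  (i : F) * ((i : F) - (d : F) - 1) * (a + b + c + (d : F) / 2 - (i : F) + 2) *
    (a + b - c + (d : F) / 2 - (i : F) + 1)

/-- `W` is (a copy of) the `(d+1)`-dimensional `ℜ`-module `R_d(a,b,c)`:  there is a basis
with respect to which `A` is lower bidiagonal with diagonal `θᵢ` and subdiagonal entries `1`,
`B` is upper bidiagonal with diagonal `θᵢ*` and superdiagonal entries `φᵢ`, and `δ` acts as
the prescribed scalar. -/
def IsRdModule (a b c : F) (d : ℕ) (W : Type) [AddCommGroup W] [Module (RacahAlg F) W] :
    Prop :=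
  letI := resF F (RacahAlg F) W
  ∃ v : Module.Basis (Fin (d + 1)) F W,
    (∀ i : Fin (d + 1), rA F • (v i : W) = thP F a d i • v i +
      (if h : (i : ℕ) + 1 < d + 1 then v ⟨(i : ℕ) + 1, h⟩ else 0)) ∧
    (∀ i : Fin (d + 1), rB F • (v i : W) = thP F b d i • v i +
      (if (i : ℕ) = 0 then 0 else
        phP F a b c d i • v ⟨(i : ℕ) - 1, lt_of_le_of_lt (Nat.sub_le _ _) i.isLt⟩)) ∧
    actsAsScalar F (rDelta F)
      ((d : F) / 2 * ((d : F) / 2 + 1) + a * (a + 1) + b * (b + 1) + c * (c + 1)) W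

/-! ## The homomorphism `ζ : ℜ → 𝔥` -/

/-- `ζ : ℜ → 𝔥` sends `A, B, C` to the prescribed elements of `𝔥`. -/
def IsZeta (ζ : RacahAlg F →ₐ[F] DAHAAlg F) : Prop :=
  ζ (rA F) = (1 / 4 : F) • ((tGen F 0 + tGen F 1 - 1) * (tGen F 0 + tGen F 1 + 1)) ∧
  ζ (rB F) = (1 / 4 : F) • ((tGen F 0 + tGen F 2 - 1) * (tGen F 0 + tGen F 2 + 1)) ∧
  ζ (rC F) = (1 / 4 : F) • ((tGen F 0 + tGen F 3 - 1) * (tGen F 0 + tGen F 3 + 1))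

/-- A `𝔥`-module considered as an `ℜ`-module via `ζ : ℜ → 𝔥`. -/
def racahModOfDaha (ζ : RacahAlg F →ₐ[F] DAHAAlg F) (V : Type) [AddCommGroup V]
    [Module (DAHAAlg F) V] : Module (RacahAlg F) V :=
  Module.compHom V ζ.toRingHom

/-! ## Composition factors -/

/-- The `i`-th factor of a composition series of submodules. -/
abbrev csFactor {R V : Type} [Ring R] [AddCommGroup V] [Module R V]
    (s : CompositionSeries (Submodule R V)) (i : Fin s.length) : Type :=
  (↥(s i.succ)) ⧸ Submodule.comap (s i.succ).subtype (s i.castSucc)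

/-! ## The `𝔥`-modules `E_d(a,b,c)` and `O_d(a,b,c)` -/

def sigP (a b c : F) (d : ℕ) : F := a + b + c - ((d : F) + 1) / 2
def tauP (a b c : F) (d : ℕ) : F := a + b - c - ((d : F) + 1) / 2
def lamP (a b c : F) (d : ℕ) : F := a - b - c - ((d : F) + 1) / 2
def muP (a b c : F) (d : ℕ) : F := c - a - b - ((d : F) + 1) / 2
def nuP (a b c : F) (d : ℕ) : F := b - a - c - ((d : F) + 1) / 2

/-- `W` is (a copy of) the `(d+1)`-dimensional `𝔥`-module `E_d(a,b,c)` (`d` odd):  there is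
a basis `v₀, …, v_d` (extended by zero to a sequence `w`) on which `t₀, t₁, t₂, t₃` act by the
prescribed formulas. -/
def IsEdModule (a b c : F) (d : ℕ) (W : Type) [AddCommGroup W] [Module (DAHAAlg F) W] :
    Prop :=
  letI := resF F (DAHAAlg F) W
  ∃ (v : Module.Basis (Fin (d + 1)) F W) (w : ℕ → W),
    (∀ i : Fin (d + 1), w i = v i) ∧ (∀ n : ℕ, d < n → w n = 0) ∧
    (∀ i : ℕ, Even i → 2 ≤ i → i + 1 ≤ d →
      tGen F 0 • w i = ((i : F) * ((d : F) - (i : F) + 1)) • w (i - 1)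
        - (((d : F) - 2 * (i : F) + 1) / 2) • w i) ∧
    (∀ i : ℕ, Odd i → i + 2 ≤ d →
      tGen F 0 • w i = (((d : F) - 2 * (i : F) - 1) / 2) • w i + w (i + 1)) ∧
    (tGen F 0 • w 0 = -(((d : F) + 1) / 2) • w 0) ∧
    (tGen F 0 • w d = -(((d : F) + 1) / 2) • w d) ∧
    (∀ i : ℕ, Even i → 2 ≤ i → i + 1 ≤ d →
      tGen F 1 • w i = ((i : F) * ((i : F) - (d : F) - 1)) • w (i - 1) + a • w i + w (i + 1)) ∧
    (∀ i : ℕ, Odd i → i ≤ d → tGen F 1 • w i = -a • w i) ∧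
    (tGen F 1 • w 0 = a • w 0 + w 1) ∧
    (∀ i : ℕ, Even i → i + 1 ≤ d → tGen F 2 • w i = b • w i) ∧
    (∀ i : ℕ, Odd i → i + 2 ≤ d →
      tGen F 2 • w i = -((sigP F a b c d + (i : F)) * (tauP F a b c d + (i : F))) • w (i - 1)
        - b • w i - w (i + 1)) ∧
    (tGen F 2 • w d = -((sigP F a b c d + (d : F)) * (tauP F a b c d + (d : F))) • w (d - 1)
      - b • w d) ∧
    (∀ i : ℕ, Even i → i + 1 ≤ d →
      tGen F 3 • w i = -((sigP F a b c d + tauP F a b c d + 2 * (i : F) + 2) / 2) • w i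
        - w (i + 1)) ∧
    (∀ i : ℕ, Odd i → i ≤ d →
      tGen F 3 • w i = ((sigP F a b c d + (i : F)) * (tauP F a b c d + (i : F))) • w (i - 1)
        + ((sigP F a b c d + tauP F a b c d + 2 * (i : F)) / 2) • w i)

/-- On `E_d(a,b,c)` the elements `t₀², t₁², t₂², t₃²` act as scalar multiplication by
`(d+1)²/4, a², b², c²` respectively. -/
def EdSquares (a b c : F) (d : ℕ) (W : Type) [AddCommGroup W] [Module (DAHAAlg F) W] :
    Prop :=
  actsAsScalar F (tGen F 0 * tGen F 0) (((d : F) + 1) ^ 2 / 4) W ∧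
  actsAsScalar F (tGen F 1 * tGen F 1) (a ^ 2) W ∧
  actsAsScalar F (tGen F 2 * tGen F 2) (b ^ 2) W ∧
  actsAsScalar F (tGen F 3 * tGen F 3) (c ^ 2) W

/-- `W` is (a copy of) the `(d+1)`-dimensional `𝔥`-module `O_d(a,b,c)` (`d` even):  there is
a basis `v₀, …, v_d` (extended by zero to a sequence `w`) on which `t₀, t₁, t₂, t₃` act by the
prescribed formulas. -/
def IsOdModule (a b c : F) (d : ℕ) (W : Type) [AddCommGroup W] [Module (DAHAAlg F) W] :
    Prop :=
  letI := resF F (DAHAAlg F) W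
  ∃ (v : Module.Basis (Fin (d + 1)) F W) (w : ℕ → W),
    (∀ i : Fin (d + 1), w i = v i) ∧ (∀ n : ℕ, d < n → w n = 0) ∧
    (∀ i : ℕ, Even i → 2 ≤ i → i ≤ d →
      tGen F 0 • w i = -((i : F) * (sigP F a b c d + (i : F))) • w (i - 1)
        + ((sigP F a b c d + 2 * (i : F)) / 2) • w i) ∧
    (∀ i : ℕ, Odd i → i + 1 ≤ d →
      tGen F 0 • w i = -((sigP F a b c d + 2 * (i : F) + 2) / 2) • w i + w (i + 1)) ∧
    (tGen F 0 • w 0 = (sigP F a b c d / 2) • w 0) ∧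
    (∀ i : ℕ, Even i → 2 ≤ i → i + 2 ≤ d →
      tGen F 1 • w i = ((i : F) * (sigP F a b c d + (i : F))) • w (i - 1)
        + (lamP F a b c d / 2) • w i + w (i + 1)) ∧
    (∀ i : ℕ, Odd i → i + 1 ≤ d → tGen F 1 • w i = -(lamP F a b c d / 2) • w i) ∧
    (tGen F 1 • w 0 = (lamP F a b c d / 2) • w 0 + w 1) ∧
    (tGen F 1 • w d = ((d : F) * (sigP F a b c d + (d : F))) • w (d - 1)
      + (lamP F a b c d / 2) • w d) ∧
    (∀ i : ℕ, Even i → i ≤ d → tGen F 2 • w i = (nuP F a b c d / 2) • w i) ∧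
    (∀ i : ℕ, Odd i → i + 1 ≤ d →
      tGen F 2 • w i = (((d : F) - (i : F) - 1) * (tauP F a b c d + (i : F))) • w (i - 1)
        - (nuP F a b c d / 2) • w i - w (i + 1)) ∧
    (∀ i : ℕ, Even i → i + 2 ≤ d →
      tGen F 3 • w i = ((2 * (d : F) + muP F a b c d - 2 * (i : F)) / 2) • w i - w (i + 1)) ∧
    (∀ i : ℕ, Odd i → i + 1 ≤ d →
      tGen F 3 • w i = (((i : F) - (d : F) - 1) * (tauP F a b c d + (i : F))) • w (i - 1)
        - ((2 * (d : F) + muP F a b c d - 2 * (i : F) + 2) / 2) • w i) ∧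
    (tGen F 3 • w d = (muP F a b c d / 2) • w d)

/-- On `O_d(a,b,c)` the elements `t₀², t₁², t₂², t₃²` act as the prescribed scalars. -/
def OdSquares (a b c : F) (d : ℕ) (W : Type) [AddCommGroup W] [Module (DAHAAlg F) W] :
    Prop :=
  actsAsScalar F (tGen F 0 * tGen F 0) (((a + b + c) / 2 - ((d : F) + 1) / 4) ^ 2) W ∧
  actsAsScalar F (tGen F 1 * tGen F 1) (((a - b - c) / 2 - ((d : F) + 1) / 4) ^ 2) W ∧
  actsAsScalar F (tGen F 2 * tGen F 2) (((c - a - b) / 2 - ((d : F) + 1) / 4) ^ 2) W ∧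
  actsAsScalar F (tGen F 3 * tGen F 3) (((b - a - c) / 2 - ((d : F) + 1) / 4) ^ 2) W

/-! ## The `{±1}²`-action on `𝔥` and twisted modules -/

theorem dahaSum : tGen F 0 + tGen F 1 + tGen F 2 + tGen F 3 = -1 := by
  have h := RingQuot.mkAlgHom_rel F (DAHARel.sum (F := F))
  simpa [tGen] using h

theorem dahaSqCentral (i j : Fin 4) :
    tGen F i * tGen F i * tGen F j = tGen F j * (tGen F i * tGen F i) := by
  have h := RingQuot.mkAlgHom_rel F (DAHARel.central (F := F) i j)
  simpa [tGen] using h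

/-- The algebra endomorphism of `𝔥` permuting the generators `t₀, t₁, t₂, t₃` by `π`. -/
def dahaAut (π : Equiv.Perm (Fin 4)) : DAHAAlg F →ₐ[F] DAHAAlg F :=
  RingQuot.liftAlgHom F ⟨FreeAlgebra.lift F (fun i => tGen F (π i)), by
    intro x y h
    cases h with
    | sum =>
        simp only [map_add, map_neg, map_one, FreeAlgebra.lift_ι_apply]
        have h4 : tGen F (π 0) + tGen F (π 1) + tGen F (π 2) + tGen F (π 3)
            = ∑ k : Fin 4, tGen F (π k) := by rw [Fin.sum_univ_four]
        rw [h4, Equiv.sum_comp π (tGen F), Fin.sum_univ_four, dahaSum]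
    | central i j =>
        simp only [map_mul, FreeAlgebra.lift_ι_apply]
        exact dahaSqCentral F (π i) (π j)⟩

/-- The element of the Klein group `{±1}²` acting on `𝔥` as the permutation of
`(t₀, t₁, t₂, t₃)` from Table 1. -/
def permOf (ε : ℤˣ × ℤˣ) : Equiv.Perm (Fin 4) :=
  if ε = (1, 1) then 1
  else if ε = (1, -1) then Equiv.swap 0 1 * Equiv.swap 2 3
  else if ε = (-1, 1) then Equiv.swap 0 2 * Equiv.swap 1 3
  else Equiv.swap 0 3 * Equiv.swap 1 2

/-- The `𝔥`-module `W^ε`: the underlying space of `W` with the action twisted by the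
automorphism of `𝔥` given by the permutation `π` of the generators. -/
def twMod (π : Equiv.Perm (Fin 4)) (W : Type) [AddCommGroup W] [Module (DAHAAlg F) W] :
    Module (DAHAAlg F) W :=
  Module.compHom W (dahaAut F π).toRingHom

/-- The trace of `x` on the twisted module `W^π`. -/
def twTrace (π : Equiv.Perm (Fin 4)) (x : DAHAAlg F) (W : Type) [AddCommGroup W]
    [Module (DAHAAlg F) W] : F :=
  @traceOf F _ (DAHAAlg F) _ _ x W _ (twMod F π W)

/-- `x` acts on the twisted module `W^π` as scalar multiplication by `μ`. -/
def twActsAsScalar (π : Equiv.Perm (Fin 4)) (x : DAHAAlg F) (μ : F) (W : Type)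
    [AddCommGroup W] [Module (DAHAAlg F) W] : Prop :=
  @actsAsScalar F _ (DAHAAlg F) _ _ x μ W _ (twMod F π W)

/-- The twisted module `W^π` is (a copy of) `E_d(a,b,c)`. -/
def twIsEdModule (π : Equiv.Perm (Fin 4)) (a b c : F) (d : ℕ) (W : Type) [AddCommGroup W]
    [Module (DAHAAlg F) W] : Prop :=
  @IsEdModule F _ a b c d W _ (twMod F π W)

end

/-- The eigenvalues of `t₀ + t₁` (and, with `b` for `a`, of `t₀ + t₂`) along a ladder. -/
def ladderEigenvalue {F : Type} [Field F] (θ a : F) (k : ℕ) : F :=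
  if Even k then a - θ + k else θ - a - k - 1

section
variable {F V : Type} [Field F] [AddCommGroup V] [Module F V]

theorem ladderEigenvalue_even (θ a : F) (m : ℕ) :
    ladderEigenvalue θ a (2 * m) = a - θ + 2 * m := by
  simp [ladderEigenvalue]

theorem ladderEigenvalue_odd (θ a : F) (m : ℕ) :
    ladderEigenvalue θ a (2 * m + 1) = θ - a - 2 * m - 2 := by
  simp [ladderEigenvalue]; ring

/-- The sequence obtained from `u` by repeatedly applying the raising operators. -/
def ladder (T : Fin 4 → Module.End F V) (θ a : F) (u : V) : ℕ → V
  | 0 => u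
  | k + 1 => (T 0 + T 1) (ladder T θ a u k) - ladderEigenvalue θ a k • ladder T θ a u k

/-- The operators `T i` define a representation of the additive DAHA on which the squares of
the generators act as `θ ^ 2`, `a ^ 2`, `b ^ 2`, `c ^ 2`. -/
structure IsDAHARep (T : Fin 4 → Module.End F V) (θ a b c : F) : Prop where
  sum (u : V) : T 0 u + T 1 u + T 2 u + T 3 u = -u
  sq0 (u : V) : T 0 (T 0 u) = θ ^ 2 • u
  sq1 (u : V) : T 1 (T 1 u) = a ^ 2 • u
  sq2 (u : V) : T 2 (T 2 u) = b ^ 2 • u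
  sq3 (u : V) : T 3 (T 3 u) = c ^ 2 • u

variable {T : Fin 4 → Module.End F V} {θ a b c : F}

/-- The four relations satisfied by `E_d(a, b, c)` at the index `2 * m`. -/
structure IsEdSeqEven (T : Fin 4 → Module.End F V) (θ a b : F) (w : ℕ → V) (m : ℕ) : Prop where
  t0 : T 0 (w (2 * m)) = (2 * m * (2 * θ - 2 * m) : F) • w (2 * m - 1) - (θ - 2 * m) • w (2 * m)
  t1 : T 1 (w (2 * m)) =
    -(2 * m * (2 * θ - 2 * m) : F) • w (2 * m - 1) + a • w (2 * m) + w (2 * m + 1)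
  t2 : T 2 (w (2 * m)) = b • w (2 * m)
  t3 : T 3 (w (2 * m)) = -(a + b - θ + 2 * m + 1) • w (2 * m) - w (2 * m + 1)

/-- The four relations satisfied by `E_d(a, b, c)` at the index `2 * m + 1`. -/
structure IsEdSeqOdd (T : Fin 4 → Module.End F V) (θ a b c : F) (w : ℕ → V) (m : ℕ) : Prop where
  t0 : T 0 (w (2 * m + 1)) = (θ - 2 * m - 2) • w (2 * m + 1) + w (2 * m + 2)
  t1 : T 1 (w (2 * m + 1)) = -a • w (2 * m + 1)
  t2 : T 2 (w (2 * m + 1)) =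
    -((a + b - θ + 2 * m + 1) ^ 2 - c ^ 2) • w (2 * m) - b • w (2 * m + 1) - w (2 * m + 2)
  t3 : T 3 (w (2 * m + 1)) =
    ((a + b - θ + 2 * m + 1) ^ 2 - c ^ 2) • w (2 * m) + (a + b - θ + 2 * m + 1) • w (2 * m + 1)

/-- The sequence `w` satisfies the relations defining the action of the additive DAHA on
`E_d(a, b, c)`, where `d = 2 * θ - 1`. -/
structure IsEdSeq (T : Fin 4 → Module.End F V) (θ a b c : F) (w : ℕ → V) : Prop where
  even (m : ℕ) : IsEdSeqEven T θ a b w m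
  odd (m : ℕ) : IsEdSeqOdd T θ a b c w m

theorem ladder_even_succ (u : V) (m : ℕ) : ladder T θ a u (2 * m + 1) =
    T 0 (ladder T θ a u (2 * m)) + T 1 (ladder T θ a u (2 * m)) -
      (a - θ + 2 * m) • ladder T θ a u (2 * m) := by
  rw [ladder, ladderEigenvalue_even, LinearMap.add_apply]

theorem ladder_odd_succ (u : V) (m : ℕ) : ladder T θ a u (2 * m + 2) =
    T 0 (ladder T θ a u (2 * m + 1)) + T 1 (ladder T θ a u (2 * m + 1)) -
      (θ - a - 2 * m - 2) • ladder T θ a u (2 * m + 1) := by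
  rw [ladder, ladderEigenvalue_odd, LinearMap.add_apply]

theorem IsEdSeqEven.odd (hT : IsDAHARep T θ a b c) {u : V} {m : ℕ}
    (h : IsEdSeqEven T θ a b (ladder T θ a u) m)
    (hp : (2 * m * (2 * θ - 2 * m) : F) • (T 1 (ladder T θ a u (2 * m - 1)) +
      a • ladder T θ a u (2 * m - 1)) = 0) :
    IsEdSeqOdd T θ a b c (ladder T θ a u) m := by
  have hs := ladder_odd_succ (T := T) (θ := θ) (a := a) u m
  obtain ⟨-, h1, h2, h3⟩ := h
  generalize ladder T θ a u = w at *
  have e1 := hT.sq1 (w (2 * m))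
  have e3 := hT.sq3 (w (2 * m))
  have es := hT.sum (w (2 * m + 1))
  rw [h1] at e1
  rw [h3] at e3
  simp only [map_add, map_sub, map_smul, h1, h3] at e1 e3
  have t1 : T 1 (w (2 * m + 1)) = -a • w (2 * m + 1) := by
    linear_combination (norm := module) e1 + hp
  have t3 : T 3 (w (2 * m + 1)) = ((a + b - θ + 2 * m + 1) ^ 2 - c ^ 2) • w (2 * m)
      + (a + b - θ + 2 * m + 1) • w (2 * m + 1) := by
    linear_combination (norm := module) -e3
  have t0 : T 0 (w (2 * m + 1)) = (θ - 2 * m - 2) • w (2 * m + 1) + w (2 * m + 2) := by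
    linear_combination (norm := module) -hs - t1
  exact ⟨t0, t1, by linear_combination (norm := module) es - t0 - t1 - t3, t3⟩

theorem IsEdSeqOdd.even_succ (hT : IsDAHARep T θ a b c) {u : V} {m : ℕ}
    (h : IsEdSeqOdd T θ a b c (ladder T θ a u) m)
    (he : T 2 (ladder T θ a u (2 * m)) = b • ladder T θ a u (2 * m)) :
    IsEdSeqEven T θ a b (ladder T θ a u) (m + 1) := by
  have hs := ladder_even_succ (T := T) (θ := θ) (a := a) u (m + 1)
  obtain ⟨h0, -, h2, -⟩ := h
  generalize ladder T θ a u = w at *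
  have e0 := hT.sq0 (w (2 * m + 1))
  have e2 := hT.sq2 (w (2 * m + 1))
  have es := hT.sum (w (2 * m + 2))
  rw [h0] at e0
  rw [h2] at e2
  simp only [map_add, map_sub, map_smul, h0, h2, he] at e0 e2
  have t0 : T 0 (w (2 * m + 2)) = (2 * (m + 1) * (2 * θ - 2 * (m + 1)) : F) • w (2 * m + 1)
      - (θ - 2 * (m + 1)) • w (2 * m + 2) := by
    linear_combination (norm := module) e0
  have t2 : T 2 (w (2 * m + 2)) = b • w (2 * m + 2) := by
    linear_combination (norm := module) -e2
  have hm : 2 * (m + 1) = 2 * m + 2 := by ring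
  rw [hm] at hs
  push_cast at hs
  have t1 : T 1 (w (2 * m + 2)) = -(2 * (m + 1) * (2 * θ - 2 * (m + 1)) : F) • w (2 * m + 1)
      + a • w (2 * m + 2) + w (2 * m + 2 + 1) := by
    linear_combination (norm := module) -hs - t0
  refine ⟨?_, ?_, ?_, ?_⟩ <;> rw [hm] <;> push_cast
  · exact t0
  · exact t1
  · exact t2
  · linear_combination (norm := module) es - t0 - t1 - t2

theorem isEdSeq_ladder (hT : IsDAHARep T θ a b c) {u : V} (h0 : T 0 u = -θ • u)
    (h2 : T 2 u = b • u) : IsEdSeq T θ a b c (ladder T θ a u) := by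
  have key : ∀ m : ℕ, IsEdSeqEven T θ a b (ladder T θ a u) m ∧
      IsEdSeqOdd T θ a b c (ladder T θ a u) m := by
    intro m
    induction m with
    | zero =>
      have hs := ladder_even_succ (T := T) (θ := θ) (a := a) u 0
      have es := hT.sum u
      have l0 : ladder T θ a u 0 = u := rfl
      simp only [mul_zero, Nat.cast_zero, l0] at hs
      have he : IsEdSeqEven T θ a b (ladder T θ a u) 0 := by
        constructor <;> simp only [mul_zero, Nat.cast_zero, l0]
        · linear_combination (norm := module) h0
        · linear_combination (norm := module) -hs - h0
        · exact h2
        · linear_combination (norm := module) es + hs - h2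
      exact ⟨he, he.odd hT (by simp)⟩
    | succ m ih =>
      have he := ih.2.even_succ hT ih.1.t2
      refine ⟨he, he.odd hT ?_⟩
      have hm : 2 * (m + 1) - 1 = 2 * m + 1 := by omega
      rw [hm, ih.2.t1]
      simp
  exact ⟨fun m => (key m).1, fun m => (key m).2⟩

theorem IsEdSeq.succ_eq {w : ℕ → V} (h : IsEdSeq T θ a b c w) (k : ℕ) :
    w (k + 1) = (T 0 + T 1) (w k) - ladderEigenvalue θ a k • w k := by
  obtain ⟨m, rfl | rfl⟩ := Nat.even_or_odd' k
  · rw [ladderEigenvalue_even, LinearMap.add_apply, (h.even m).t0, (h.even m).t1]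
    module
  · rw [ladderEigenvalue_odd, LinearMap.add_apply, (h.odd m).t0, (h.odd m).t1]
    module

theorem IsEdSeq.exists_lower {w : ℕ → V} (h : IsEdSeq T θ a b c w) (k : ℕ) :
    ∃ r : F, (T 0 + T 2) (w k) - ladderEigenvalue θ b k • w k = r • w (k - 1) ∧
      (k = 0 → r = 0) := by
  obtain ⟨m, rfl | rfl⟩ := Nat.even_or_odd' k
  · refine ⟨2 * m * (2 * θ - 2 * m), ?_, fun hk => ?_⟩
    · rw [ladderEigenvalue_even, LinearMap.add_apply, (h.even m).t0, (h.even m).t2]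
      module
    · obtain rfl : m = 0 := by omega
      simp
  · refine ⟨-((a + b - θ + 2 * m + 1) ^ 2 - c ^ 2), ?_, by omega⟩
    rw [ladderEigenvalue_odd, LinearMap.add_apply, (h.odd m).t0, (h.odd m).t2,
      Nat.add_sub_cancel]
    module

open Polynomial in
theorem aeval_prod_eq_of_succ_eq {A : Module.End F V} {x : ℕ → F} {w : ℕ → V}
    (h : ∀ k, w (k + 1) = A (w k) - x k • w k) (k : ℕ) :
    aeval A (∏ i ∈ Finset.range k, (X - C (x i))) (w 0) = w k := by
  induction k with
  | zero => simp
  | succ k ih =>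
    rw [Finset.prod_range_succ, mul_comm, map_mul, Module.End.mul_apply, ih, h k]
    simp [Module.algebraMap_end_apply]

theorem ladder_eq_zero {w : ℕ → V} (h : IsEdSeq T θ a b c w)
    (hs : Submodule.span F (Set.range w) = ⊤) {N : ℕ} (hN : w N = 0) (u : V) :
    ladder T θ a u N = 0 := by
  set p : Polynomial F := ∏ i ∈ Finset.range N, (.X - .C (ladderEigenvalue θ a i)) with hp
  have hp0 : Polynomial.aeval (T 0 + T 1) p = 0 := by
    refine LinearMap.ext_on_range hs fun k => ?_
    rw [← aeval_prod_eq_of_succ_eq h.succ_eq k, ← Module.End.mul_apply, ← map_mul, mul_comm,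
      map_mul, Module.End.mul_apply, aeval_prod_eq_of_succ_eq h.succ_eq N, hN]
    simp
  have hl := aeval_prod_eq_of_succ_eq (w := ladder T θ a u) (A := T 0 + T 1)
    (x := ladderEigenvalue θ a) (fun k => rfl) N
  rw [← hl, ← hp, hp0, LinearMap.zero_apply]

theorem IsEdSeq.eq_ladderEigenvalue {w : ℕ → V} (h : IsEdSeq T θ a b c w)
    (hs : Submodule.span F (Set.range w) = ⊤) {N : ℕ} (hN : ∀ k, N ≤ k → w k = 0)
    {u : V} (hu : u ≠ 0) {y : F} (hy : (T 0 + T 2) u = y • u) :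
    ∃ k < N, y = ladderEigenvalue θ b k := by
  set p : ℕ → Polynomial F := fun k =>
    ∏ i ∈ Finset.range k, (.X - .C (ladderEigenvalue θ b i)) with hp
  have hw : ∀ k, Polynomial.aeval (T 0 + T 2) (p (k + 1)) (w k) = 0 := by
    intro k
    induction k with
    | zero =>
      obtain ⟨r, hr, hr0⟩ := h.exists_lower 0
      rw [hr0 rfl] at hr
      simpa [hp, Module.algebraMap_end_apply] using hr
    | succ k ih =>
      obtain ⟨r, hr, -⟩ := h.exists_lower (k + 1)
      have : p (k + 1 + 1) = p (k + 1) * (.X - .C (ladderEigenvalue θ b (k + 1))) :=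
        Finset.prod_range_succ _ _
      rw [this, map_mul, Module.End.mul_apply, map_sub, Polynomial.aeval_X, Polynomial.aeval_C,
        LinearMap.sub_apply, Module.algebraMap_end_apply, hr, Nat.add_sub_cancel, map_smul, ih,
        smul_zero]
  have hp0 : Polynomial.aeval (T 0 + T 2) (p N) = 0 := by
    refine LinearMap.ext_on_range hs fun k => ?_
    rcases le_or_gt N k with hk | hk
    · rw [hN k hk]; simp
    · obtain ⟨q, hq⟩ : p (k + 1) ∣ p N :=
        Finset.prod_dvd_prod_of_subset _ _ _ (Finset.range_subset_range.2 hk)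
      rw [hq, mul_comm, map_mul, Module.End.mul_apply, hw]
      simp
  have he : (p N).eval y • u = 0 := by
    have hev : (T 0 + T 2).HasEigenvector y u :=
      ⟨Module.End.mem_eigenspace_iff.2 hy, hu⟩
    rw [← Module.End.aeval_apply_of_hasEigenvector hev, hp0, LinearMap.zero_apply]
  have := (smul_eq_zero.1 he).resolve_right hu
  rw [hp, Polynomial.eval_prod, Finset.prod_eq_zero_iff] at this
  obtain ⟨k, hk, hroot⟩ := this
  refine ⟨k, Finset.mem_range.1 hk, ?_⟩
  simpa [sub_eq_zero] using hroot

/-- A sum of two operators with scalar squares has eigenvalues symmetric about zero, except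
where an eigenvector is shared by both summands. -/
theorem exists_neg_eigenvector_or [CharZero F] {S S' : Module.End F V} {α β z : F}
    (hS : ∀ u, S (S u) = α • u) (hS' : ∀ u, S' (S' u) = β • u) {W : Submodule F V}
    (hW : ∀ u ∈ W, S u ∈ W) {u : V} (hu : u ∈ W) (hu0 : u ≠ 0) (hz : S u + S' u = z • u) :
    (∃ x ∈ W, x ≠ 0 ∧ S x + S' x = -z • x) ∨
      ∃ s : F, S u = s • u ∧ s ^ 2 = α ∧ (z - s) ^ 2 = β := by
  by_cases hz0 : z = 0
  · exact .inl ⟨u, hu, hu0, by rw [hz, hz0, neg_zero]⟩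
  by_cases hx : (2 * z) • S u - (z ^ 2 + α - β) • u = 0
  · right
    obtain ⟨s, hs⟩ : ∃ s : F, S u = s • u := by
      refine ⟨(2 * z)⁻¹ * (z ^ 2 + α - β), ?_⟩
      rw [mul_smul, ← sub_eq_zero.1 hx, inv_smul_smul₀ (by simpa using hz0)]
    have hs' : S' u = (z - s) • u := by
      linear_combination (norm := module) hz - hs
    refine ⟨s, hs, ?_, ?_⟩
    · refine smul_left_injective F hu0 ?_
      simp only [← hS u, hs, map_smul]
      module
    · refine smul_left_injective F hu0 ?_
      simp only [← hS' u, hs', map_smul]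
      module
  · refine .inl ⟨_, W.sub_mem (W.smul_mem _ (hW u hu)) (W.smul_mem _ hu), hx, ?_⟩
    have h1 : S' u = z • u - S u := by linear_combination (norm := module) hz
    have h2 : S' (S u) = z • (z • u - S u) - β • u := by
      have := hS' u
      rw [h1, map_sub, map_smul, h1] at this
      linear_combination (norm := module) -this
    simp only [map_sub, map_smul, hS, h1, h2]
    module

/-- No nonempty set of ladder eigenvalues is closed under both reflections. -/
theorem not_reflection_closed [CharZero F] (n : ℕ) (b : F) {Λ : F → Prop} (hex : ∃ y, Λ y)
    (hmem : ∀ y, Λ y → ∃ k < 2 * n + 2, y = ladderEigenvalue (n + 1 : F) b k)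
    (h2 : ∀ k < 2 * n + 2, Λ (ladderEigenvalue (n + 1 : F) b k) →
      Λ (-2 - ladderEigenvalue (n + 1 : F) b k))
    (h0 : ∀ y, Λ y → Λ (-y) ∨ (y - (n + 1)) ^ 2 = b ^ 2) : False := by
  set z : ℕ → F := fun m => b - (n + 1) + 2 * m with hz
  have hup : ∀ m ≤ n, Λ (z m) → Λ (-z (m + 1)) := fun m hm h => by
    have := h2 (2 * m) (by omega) (by rwa [ladderEigenvalue_even])
    rw [ladderEigenvalue_even] at this
    convert this using 1; simp only [hz]; push_cast; ring
  have hdown : ∀ m ≤ n, Λ (-z (m + 1)) → Λ (z m) := fun m hm h => by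
    have e : ladderEigenvalue (n + 1 : F) b (2 * m + 1) = -z (m + 1) := by
      rw [ladderEigenvalue_odd]; simp only [hz]; push_cast; ring
    have := h2 (2 * m + 1) (by omega) (by rwa [e])
    rw [e] at this
    convert this using 1; simp only [hz]; push_cast; ring
  have hmem' : ∀ y, Λ y → ∃ m ≤ n, y = z m ∨ y = -z (m + 1) := fun y hy => by
    obtain ⟨k, hk, rfl⟩ := hmem y hy
    obtain ⟨m, rfl | rfl⟩ := Nat.even_or_odd' k
    · exact ⟨m, by omega, .inl (ladderEigenvalue_even _ _ _)⟩
    · refine ⟨m, by omega, .inr ?_⟩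
      rw [ladderEigenvalue_odd]; simp only [hz]; push_cast; ring
  have h0' : ∀ y, Λ y → Λ (-y) ∨ y = z (n + 1) ∨ y = -z 0 := fun y hy => by
    refine (h0 y hy).imp_right fun h => ?_
    rcases sq_eq_sq_iff_eq_or_eq_neg.1 h with h | h
    · left; simp only [hz]; push_cast; linear_combination h
    · right; simp only [hz]; push_cast; linear_combination h
  have hne : ∃ m, m ≤ n ∧ Λ (z m) := by
    obtain ⟨y, hy⟩ := hex
    obtain ⟨m, hm, rfl | rfl⟩ := hmem' y hy
    · exact ⟨m, hm, hy⟩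
    · exact ⟨m, hm, hdown m hm hy⟩
  -- the bottom of the set forces `z 0` to be a small nonpositive integer
  have hlow : ∃ j ≤ n, z 0 + j = 0 := by
    classical
    obtain ⟨hm, hm'⟩ := Nat.find_spec hne
    have hmin := fun k => Nat.find_min (H := hne) (m := k)
    generalize Nat.find hne = m at *
    rcases h0' _ hm' with h | h | h
    · cases m with
      | zero =>
        obtain ⟨j, hj, h | h⟩ := hmem' _ h
        · refine ⟨j, hj, mul_left_cancel₀ (two_ne_zero' F) ?_⟩
          simp only [hz] at h ⊢; push_cast at h ⊢; linear_combination -h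
        · have : ((j + 1 : ℕ) : F) = 0 := mul_left_cancel₀ (two_ne_zero' F) (by
            simp only [hz] at h; push_cast at h ⊢; linear_combination h)
          exact absurd this (Nat.cast_ne_zero.2 (by omega))
      | succ m => exact absurd ⟨by omega, hdown m (by omega) h⟩ (hmin m (by omega))
    · have : (m : F) = (n + 1 : ℕ) := mul_left_cancel₀ (two_ne_zero' F) (by
        simp only [hz] at h; push_cast at h ⊢; linear_combination h)
      have := Nat.cast_injective this
      omega
    · refine ⟨m, hm, mul_left_cancel₀ (two_ne_zero' F) ?_⟩
      simp only [hz] at h ⊢; push_cast at h ⊢; linear_combination h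
  -- the top of the set forces `z 0` to be a large negative integer
  have hhigh : ∃ j, z 0 + (n + 2 + j : ℕ) = 0 := by
    classical
    obtain ⟨k, hk, hk'⟩ := hne
    have hm := Nat.findGreatest_le (P := fun m => Λ (z m)) n
    have hm' := Nat.findGreatest_spec (P := fun m => Λ (z m)) hk hk'
    have hmax := fun k => Nat.findGreatest_is_greatest (P := fun m => Λ (z m)) (n := n) (k := k)
    generalize Nat.findGreatest (fun m => Λ (z m)) n = m at *
    rcases h0' _ (hup m hm hm') with h | h | h
    · rw [neg_neg] at h
      rcases hm.lt_or_eq with hlt | rfl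
      · exact absurd h (hmax (m + 1) (by omega) (by omega))
      · obtain ⟨j, hj, h | h⟩ := hmem' _ h
        · have : ((m + 1 : ℕ) : F) = j := mul_left_cancel₀ (two_ne_zero' F) (by
            simp only [hz] at h; push_cast at h ⊢; linear_combination h)
          have := Nat.cast_injective this
          omega
        · refine ⟨j, mul_left_cancel₀ (two_ne_zero' F) ?_⟩
          simp only [hz] at h ⊢; push_cast at h ⊢; linear_combination h
    · refine ⟨m, mul_left_cancel₀ (two_ne_zero' F) ?_⟩
      simp only [hz] at h ⊢; push_cast at h ⊢; linear_combination -h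
    · have : ((m + 1 : ℕ) : F) = 0 := mul_left_cancel₀ (two_ne_zero' F) (by
        simp only [hz] at h; push_cast at h ⊢; linear_combination -h)
      exact absurd this (Nat.cast_ne_zero.2 (by omega))
  obtain ⟨i, hi, hi'⟩ := hlow
  obtain ⟨j, hj⟩ := hhigh
  have : (i : F) = (n + 2 + j : ℕ) := by linear_combination hi' - hj
  have := Nat.cast_injective this
  omega

theorem IsEdSeq.mem_of_mem [CharZero F] {n : ℕ} {w : ℕ → V}
    (h : IsEdSeq T (n + 1 : F) a b c w)
    (hρ : ∀ m ≤ n, (a + b - (n + 1) + 2 * m + 1) ^ 2 ≠ c ^ 2) {W : Submodule F V}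
    (hW : ∀ i, ∀ u ∈ W, T i u ∈ W) {k : ℕ} (hk : k ≤ 2 * n + 1) (hkW : w k ∈ W) (j : ℕ) :
    w j ∈ W := by
  have h0 : w 0 ∈ W := by
    induction k with
    | zero => exact hkW
    | succ k ih =>
      refine ih (by omega) ?_
      obtain ⟨m, rfl | rfl⟩ := Nat.even_or_odd' k
      · refine (W.smul_mem_iff (sub_ne_zero.2 (hρ m (by omega)))).1 ?_
        rw [← (W.add_mem_iff_left (W.smul_mem _ hkW)), ← (h.odd m).t3]
        exact hW 3 _ hkW
      · have hne : (2 * (m + 1 : ℕ) * (2 * (n + 1) - 2 * (m + 1 : ℕ)) : F) ≠ 0 := by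
          refine mul_ne_zero (mul_ne_zero two_ne_zero (Nat.cast_ne_zero.2 (by omega))) ?_
          rw [← mul_sub]
          refine mul_ne_zero two_ne_zero (sub_ne_zero.2 ?_)
          exact_mod_cast (show n + 1 ≠ m + 1 by omega)
        have hm := (h.even (m + 1)).t0
        rw [show 2 * (m + 1) - 1 = 2 * m + 1 by omega,
          show 2 * (m + 1) = 2 * m + 1 + 1 by ring] at hm
        refine (W.smul_mem_iff hne).1 ?_
        rw [← W.sub_mem_iff_left (W.smul_mem _ hkW), ← hm]
        exact hW 0 _ hkW
  induction j with
  | zero => exact h0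
  | succ j ih =>
    rw [h.succ_eq, LinearMap.add_apply]
    exact W.sub_mem (W.add_mem (hW 0 _ ih) (hW 1 _ ih)) (W.smul_mem _ ih)

theorem IsEdSeq.map_mem_span {w : ℕ → V} (h : IsEdSeq T θ a b c w) {j : ℕ}
    (hj : j = 0 ∨ ∃ m, j = 2 * m + 1 ∧ (a + b - θ + 2 * m + 1) ^ 2 = c ^ 2) (i : Fin 4) :
    ∀ u ∈ Submodule.span F (w '' Set.Ici j), T i u ∈ Submodule.span F (w '' Set.Ici j) := by
  set W := Submodule.span F (w '' Set.Ici j) with hW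
  have hw : ∀ k, j ≤ k → w k ∈ W := fun k hk => Submodule.subset_span ⟨k, hk, rfl⟩
  have hprev : ∀ k, j ≤ 2 * k →
      (2 * k * (2 * θ - 2 * k) : F) • w (2 * k - 1) ∈ W := fun k hk => by
    rcases Nat.eq_zero_or_pos k with rfl | hk0
    · simp
    · refine W.smul_mem _ (hw _ ?_)
      rcases hj with rfl | ⟨m, rfl, -⟩ <;> omega
  have hprev' : ∀ k, j ≤ 2 * k + 1 →
      ((a + b - θ + 2 * k + 1) ^ 2 - c ^ 2) • w (2 * k) ∈ W := fun k hk => by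
    rcases hj with rfl | ⟨m, rfl, hm⟩
    · exact W.smul_mem _ (hw _ (Nat.zero_le _))
    · rcases eq_or_ne k m with rfl | hkm
      · rw [hm, sub_self, zero_smul]; exact W.zero_mem
      · exact W.smul_mem _ (hw _ (by omega))
  have hle : W ≤ W.comap (T i) := by
    rw [hW, Submodule.span_le, ← hW]
    rintro _ ⟨k, hk, rfl⟩
    change j ≤ k at hk
    change T i (w k) ∈ W
    obtain ⟨m, rfl | rfl⟩ := Nat.even_or_odd' k
    · have w1 := hw _ hk
      have w2 := hw (2 * m + 1) (by omega)
      have w0 := hprev m hk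
      fin_cases i
      · exact (h.even m).t0 ▸ W.sub_mem w0 (W.smul_mem _ w1)
      · refine (h.even m).t1 ▸ W.add_mem (W.add_mem ?_ (W.smul_mem _ w1)) w2
        rw [neg_smul]; exact W.neg_mem w0
      · exact (h.even m).t2 ▸ W.smul_mem _ w1
      · exact (h.even m).t3 ▸ W.sub_mem (W.smul_mem _ w1) w2
    · have w1 := hw _ hk
      have w2 := hw (2 * m + 2) (by omega)
      have w0 := hprev' m hk
      fin_cases i
      · exact (h.odd m).t0 ▸ W.add_mem (W.smul_mem _ w1) w2
      · exact (h.odd m).t1 ▸ W.smul_mem _ w1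
      · refine (h.odd m).t2 ▸ W.sub_mem (W.sub_mem ?_ (W.smul_mem _ w1)) w2
        rw [neg_smul]; exact W.neg_mem w0
      · exact (h.odd m).t3 ▸ W.add_mem w0 (W.smul_mem _ w1)
  exact hle

theorem span_image_Ici_zero (w : ℕ → V) :
    Submodule.span F (w '' Set.Ici 0) = Submodule.span F (Set.range w) := by
  rw [show Set.Ici 0 = Set.univ from Set.eq_univ_of_forall Nat.zero_le, Set.image_univ]

theorem span_range_fin_eq {w : ℕ → V} {N : ℕ} (hN : ∀ k, N ≤ k → w k = 0) :
    Submodule.span F (Set.range fun i : Fin N => w i) = Submodule.span F (Set.range w) := by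
  refine le_antisymm (Submodule.span_mono ?_) (Submodule.span_le.2 ?_)
  · rintro _ ⟨i, rfl⟩
    exact ⟨i, rfl⟩
  · rintro _ ⟨k, rfl⟩
    rcases lt_or_ge k N with hk | hk
    · exact Submodule.subset_span ⟨⟨k, hk⟩, rfl⟩
    · simp [hN k hk]

theorem IsEdSeq.eq_zero_of_le {w : ℕ → V} (h : IsEdSeq T θ a b c w) {N k : ℕ} (hN : w N = 0)
    (hk : N ≤ k) : w k = 0 := by
  induction k, hk using Nat.le_induction with
  | base => exact hN
  | succ k _ ih => rw [h.succ_eq, ih]; simp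

theorem IsEdSeq.exists_invariant {n : ℕ} {w : ℕ → V}
    (h : IsEdSeq T θ a b c w) (hs : Submodule.span F (Set.range w) = ⊤)
    (hN : w (2 * n + 2) = 0) (hV : Module.finrank F V = 2 * n + 2) {m : ℕ} (hm : m ≤ n)
    (hρ : (a + b - θ + 2 * m + 1) ^ 2 = c ^ 2) :
    ∃ W : Submodule F V, (∀ i, ∀ u ∈ W, T i u ∈ W) ∧ W ≠ ⊥ ∧ W ≠ ⊤ := by
  have hN' : ∀ k, 2 * n + 2 ≤ k → w k = 0 := fun k => h.eq_zero_of_le hN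
  have hli : LinearIndependent F (fun i : Fin (2 * n + 2) => w i) :=
    linearIndependent_of_top_le_span_of_card_eq_finrank
      (by rw [span_range_fin_eq hN', hs]) (by simp [hV])
  refine ⟨_, h.map_mem_span (.inr ⟨m, rfl, hρ⟩), fun hbot => ?_, fun htop => ?_⟩
  · refine hli.ne_zero ⟨2 * m + 1, by omega⟩ ?_
    rw [← Submodule.mem_bot F, ← hbot]
    exact Submodule.subset_span ⟨_, Set.mem_Ici.2 le_rfl, rfl⟩
  · refine hli.notMem_span_image (s := {i | i ≠ 0}) (x := 0) (by simp) ?_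
    have : w '' Set.Ici (2 * m + 1) ⊆
        Submodule.span F ((fun i : Fin (2 * n + 2) => w i) '' {i | i ≠ 0}) := by
      rintro _ ⟨k, hk, rfl⟩
      rcases lt_or_ge k (2 * n + 2) with hlt | hge
      · refine Submodule.subset_span ⟨⟨k, hlt⟩, ?_, rfl⟩
        rw [Set.mem_ofPred_eq, Ne, Fin.ext_iff]
        have := Set.mem_Ici.1 hk
        simp only [Fin.val_zero]
        omega
      · simp [hN' k hge]
    exact Submodule.span_le.2 this (htop ▸ Submodule.mem_top)

/-- On the span of an `IsEdSeq`, the eigenvalues `-θ` of `t₀` and `-b` of `t₂` share an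
eigenvector. -/
theorem IsEdSeq.exists_common_eigenvector [CharZero F] {n : ℕ} {w : ℕ → V}
    (h : IsEdSeq T (n + 1 : F) a b c w) (hs : Submodule.span F (Set.range w) = ⊤)
    (hN : w (2 * n + 2) = 0) (hV : Module.finrank F V = 2 * n + 2) :
    ∃ u ≠ 0, T 0 u = -(n + 1 : F) • u ∧ T 2 u = -b • u := by
  have hN' : ∀ k, 2 * n + 2 ≤ k → w k = 0 := fun k => h.eq_zero_of_le hN
  have hfin : FiniteDimensional F V := FiniteDimensional.of_finrank_pos (by omega)
  set A := T 0 + (n + 1 : F) • LinearMap.id with hA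
  set B := T 2 + b • LinearMap.id with hB
  set P := Submodule.span F (Set.range fun m : Fin n => A (w (2 * m + 1))) with hP
  set Q := Submodule.span F (Set.range fun m : Fin (n + 1) => w (2 * m)) with hQ
  have hwQ : ∀ m, w (2 * m) ∈ Q := fun m => by
    rcases lt_or_ge m (n + 1) with hm | hm
    · exact Submodule.subset_span ⟨⟨m, hm⟩, rfl⟩
    · rw [hN' _ (by omega)]; exact Q.zero_mem
  have hodd : ∀ m, A (w (2 * m + 1)) ∈ P := fun m => by
    rcases lt_trichotomy m n with hm | rfl | hm
    · exact Submodule.subset_span ⟨⟨m, hm⟩, rfl⟩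
    · have : A (w (2 * m + 1)) = 0 := by
        simp only [hA, LinearMap.add_apply, (h.odd m).t0, hN, LinearMap.smul_apply,
          LinearMap.id_apply]
        module
      rw [this]; exact P.zero_mem
    · rw [hN' _ (by omega), map_zero]; exact P.zero_mem
  have hAP : ∀ u, A u ∈ P := by
    suffices ⊤ ≤ P.comap A from fun u => this Submodule.mem_top
    rw [← hs, Submodule.span_le]
    rintro _ ⟨k, rfl⟩
    change A (w k) ∈ P
    obtain ⟨m, rfl | rfl⟩ := Nat.even_or_odd' k
    · have : A (w (2 * m)) = (2 * m : F) • A (w (2 * m - 1)) := by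
        cases m with
        | zero =>
          have := (h.even 0).t0
          simp only [mul_zero, Nat.cast_zero] at this
          simp only [hA, LinearMap.add_apply, mul_zero, this, Nat.cast_zero,
            LinearMap.smul_apply, LinearMap.id_apply]
          module
        | succ m =>
          have h1 := (h.even (m + 1)).t0
          have h2 := (h.odd m).t0
          rw [show 2 * (m + 1) - 1 = 2 * m + 1 by omega] at *
          rw [show 2 * (m + 1) = 2 * m + 2 by ring] at *
          simp only [hA, LinearMap.add_apply, h1, h2, LinearMap.smul_apply,
            LinearMap.id_apply]
          push_cast
          module
      rw [this]
      refine P.smul_mem _ ?_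
      cases m with
      | zero =>
        have := (h.even 0).t0
        simp only [mul_zero, Nat.cast_zero] at this
        have : A (w 0) = 0 := by
          simp only [hA, LinearMap.add_apply, this, LinearMap.smul_apply, LinearMap.id_apply]
          module
        simp [this]
      | succ m => exact hodd m
    · exact hodd m
  have hBQ : ∀ u, B u ∈ Q := by
    suffices ⊤ ≤ Q.comap B from fun u => this Submodule.mem_top
    rw [← hs, Submodule.span_le]
    rintro _ ⟨k, rfl⟩
    change B (w k) ∈ Q
    obtain ⟨m, rfl | rfl⟩ := Nat.even_or_odd' k
    · simp only [hB, LinearMap.add_apply, (h.even m).t2, LinearMap.smul_apply, LinearMap.id_apply]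
      exact Q.add_mem (Q.smul_mem _ (hwQ m)) (Q.smul_mem _ (hwQ m))
    · have : B (w (2 * m + 1)) =
          -((a + b - (n + 1) + 2 * m + 1) ^ 2 - c ^ 2) • w (2 * m) - w (2 * (m + 1)) := by
        simp only [hB, LinearMap.add_apply, (h.odd m).t2, LinearMap.smul_apply,
          LinearMap.id_apply, mul_add, mul_one]
        module
      rw [this]
      exact Q.sub_mem (Q.smul_mem _ (hwQ m)) (hwQ (m + 1))
  have hPle : Module.finrank F P ≤ n := (finrank_range_le_card _).trans (by simp)
  have hQle : Module.finrank F Q ≤ n + 1 := (finrank_range_le_card _).trans (by simp)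
  have hker := LinearMap.ker_ne_bot_of_finrank_lt
    (f := (A.codRestrict P hAP).prod (B.codRestrict Q hBQ))
    (by rw [Module.finrank_prod, hV]; omega)
  obtain ⟨u, hu, hu0⟩ := Submodule.exists_mem_ne_zero_of_ne_bot hker
  rw [LinearMap.mem_ker] at hu
  have hu1 : A u = 0 := congrArg (fun x => (x.1 : V)) hu
  have hu2 : B u = 0 := congrArg (fun x => (x.2 : V)) hu
  simp only [hA, hB, LinearMap.add_apply, LinearMap.smul_apply, LinearMap.id_apply] at hu1 hu2
  exact ⟨u, hu0, by linear_combination (norm := module) hu1,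
    by linear_combination (norm := module) hu2⟩

theorem IsEdSeq.mem_span_last {d : ℕ} {w : ℕ → V} (h : IsEdSeq T θ a b c w)
    (v : Module.Basis (Fin (d + 1)) F V) (hv : ∀ i : Fin (d + 1), w i = v i)
    (hw : ∀ k, d < k → w k = 0) {u : V}
    (hu : (T 0 + T 1) u = ladderEigenvalue θ a d • u) : u ∈ Submodule.span F {w d} := by
  have hcoord : ∀ (j : Fin (d + 1)) (k : ℕ), v.coord j (w k) = if k = j then 1 else 0 := by
    intro j k
    rcases le_or_gt k d with hk | hk
    · have := hv ⟨k, by omega⟩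
      simp only at this
      rw [this, Module.Basis.coord_apply, Module.Basis.repr_self, Finsupp.single_apply]
      simp [Fin.ext_iff]
    · rw [hw k hk, map_zero, if_neg (by omega)]
  have hrec : ∀ i (hi : i < d) (x : V), v.coord ⟨i + 1, by omega⟩ ((T 0 + T 1) x) =
      ladderEigenvalue θ a (i + 1) * v.coord ⟨i + 1, by omega⟩ x +
        v.coord ⟨i, by omega⟩ x := by
    intro i hi x
    have : v.coord ⟨i + 1, by omega⟩ ∘ₗ (T 0 + T 1) =
        ladderEigenvalue θ a (i + 1) • v.coord ⟨i + 1, by omega⟩ + v.coord ⟨i, by omega⟩ := by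
      refine v.ext fun k => ?_
      have hk := h.succ_eq k
      rw [eq_sub_iff_add_eq, eq_comm] at hk
      rw [← hv k, LinearMap.comp_apply, hk]
      simp only [map_add, map_smul, hcoord, LinearMap.add_apply, LinearMap.smul_apply,
        smul_eq_mul, add_left_inj]
      rcases eq_or_ne (k : ℕ) (i + 1) with hki | hki
      · rw [hki]; simp
      · simp [hki]
    simpa using LinearMap.congr_fun this x
  have hzero : ∀ i (hi : i < d), v.coord ⟨i, by omega⟩ u = 0 := by
    suffices ∀ k, ∀ i (hi : i < d), d = i + 1 + k → v.coord ⟨i, by omega⟩ u = 0 from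
      fun i hi => this (d - (i + 1)) i hi (by omega)
    intro k
    induction k with
    | zero =>
      intro i hi hd
      have := hrec i hi u
      rw [hu, map_smul, smul_eq_mul] at this
      simp only [show d = i + 1 by omega] at this
      linear_combination -this
    | succ k ih =>
      intro i hi hd
      have := hrec i hi u
      rw [hu, map_smul, smul_eq_mul, ih (i + 1) (by omega) (by omega)] at this
      linear_combination -this
  rw [Submodule.mem_span_singleton]
  refine ⟨v.coord ⟨d, by omega⟩ u, ?_⟩
  refine v.ext_elem fun i => ?_
  have h1 := hcoord i d
  rw [Module.Basis.coord_apply] at h1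
  rw [map_smul, Finsupp.smul_apply, h1]
  rcases eq_or_ne (i : ℕ) d with hi | hi
  · have hi' : i = ⟨d, by omega⟩ := Fin.ext hi
    rw [hi']
    simp
  · have := hzero i (by omega)
    rw [Module.Basis.coord_apply] at this
    rw [this, if_neg (Ne.symm hi), smul_zero]

/-- An invariant subspace with a common eigenvector of `t₀` (eigenvalue `-θ`) and `t₂` is
everything. -/
theorem IsEdSeq.eq_top_of_mem [CharZero F] {n : ℕ} {w : ℕ → V}
    (h : IsEdSeq T (n + 1 : F) a b c w)
    (v : Module.Basis (Fin (2 * n + 1 + 1)) F V) (hv : ∀ i : Fin (2 * n + 1 + 1), w i = v i)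
    (hw : ∀ k, 2 * n + 1 < k → w k = 0)
    (hs : Submodule.span F (Set.range w) = ⊤)
    (hρ : ∀ m ≤ n, (a + b - (n + 1) + 2 * m + 1) ^ 2 ≠ c ^ 2) {β : F}
    (hT : IsDAHARep T (n + 1 : F) a β c)
    (hβ : ∀ m ≤ n, (a + β - (n + 1) + 2 * m + 1) ^ 2 ≠ c ^ 2)
    {W : Submodule F V} (hW : ∀ i, ∀ u ∈ W, T i u ∈ W) {u : V} (hu : u ∈ W) (hu0 : u ≠ 0)
    (h0 : T 0 u = -(n + 1 : F) • u) (h2 : T 2 u = β • u) : W = ⊤ := by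
  have hl := isEdSeq_ladder hT h0 h2
  set x := ladder T (n + 1 : F) a u (2 * n + 1) with hx
  have hxW : x ∈ W := hl.mem_of_mem hβ hW (k := 0) (by omega) hu _
  have hx0 : x ≠ 0 := fun hx0 => hu0 ((Submodule.mem_bot F).1
    (hl.mem_of_mem hβ (W := ⊥) (by simp) le_rfl ((Submodule.mem_bot F).2 hx0) 0))
  have hlast : ladder T (n + 1 : F) a u (2 * n + 2) = 0 :=
    ladder_eq_zero h hs (hw _ (by omega)) u
  have hxe : (T 0 + T 1) x = ladderEigenvalue (n + 1 : F) a (2 * n + 1) • x := by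
    rw [← sub_eq_zero, ← hlast]; rfl
  obtain ⟨r, hr⟩ := Submodule.mem_span_singleton.1 (h.mem_span_last v hv hw hxe)
  have hr0 : r ≠ 0 := by rintro rfl; exact hx0 (by rw [← hr, zero_smul])
  have hwW : w (2 * n + 1) ∈ W := (W.smul_mem_iff hr0).1 (hr ▸ hxW)
  rw [eq_top_iff, ← hs, Submodule.span_le]
  rintro _ ⟨j, rfl⟩
  exact h.mem_of_mem hρ hW le_rfl hwW j

theorem IsDAHARep.neg_b (hT : IsDAHARep T θ a b c) : IsDAHARep T θ a (-b) c :=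
  ⟨hT.sum, hT.sq0, hT.sq1, by simpa using hT.sq2, hT.sq3⟩

theorem IsEdSeq.isDAHARep {w : ℕ → V} (h : IsEdSeq T θ a b c w)
    (hs : Submodule.span F (Set.range w) = ⊤) (hsum : ∀ u, T 0 u + T 1 u + T 2 u + T 3 u = -u)
    (hc : ∀ i j u, T i (T i (T j u)) = T j (T i (T i u))) : IsDAHARep T θ a b c := by
  have key : ∀ (i : Fin 4) (r : F), T i (T i (w 0)) = r • w 0 → ∀ u, T i (T i u) = r • u := by
    intro i r h0 u
    have : T i ∘ₗ T i = r • LinearMap.id := by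
      refine LinearMap.ext_on_range hs fun k => ?_
      change T i (T i (w k)) = r • w k
      induction k with
      | zero => exact h0
      | succ k ih =>
        rw [h.succ_eq]
        simp only [LinearMap.add_apply, map_sub, map_add, map_smul]
        rw [hc i 0, hc i 1, ih]
        simp only [map_smul]
        module
    exact LinearMap.congr_fun this u
  obtain ⟨e0, e1, e2, e3⟩ := h.even 0
  obtain ⟨o0, o1, o2, o3⟩ := h.odd 0
  simp only [mul_zero, Nat.cast_zero, zero_add] at e0 e1 e2 e3 o0 o1 o2 o3
  refine ⟨hsum, key 0 _ ?_, key 1 _ ?_, key 2 _ ?_, key 3 _ ?_⟩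
  · rw [e0]; simp only [map_sub, map_smul, e0]; module
  · rw [e1]; simp only [map_add, map_smul, e1, o1]; module
  · rw [e2]; simp only [map_smul, e2]; module
  · rw [e3]; simp only [map_sub, map_smul, e3, o3]; module

theorem IsEdSeq.forall_invariant_iff [CharZero F] [IsAlgClosed F] {n : ℕ} {w : ℕ → V}
    (h : IsEdSeq T (n + 1 : F) a b c w)
    (v : Module.Basis (Fin (2 * n + 1 + 1)) F V) (hv : ∀ i : Fin (2 * n + 1 + 1), w i = v i)
    (hw : ∀ k, 2 * n + 1 < k → w k = 0)
    (hsum : ∀ u, T 0 u + T 1 u + T 2 u + T 3 u = -u)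
    (hc : ∀ i j u, T i (T i (T j u)) = T j (T i (T i u))) :
    (∀ W : Submodule F V, (∀ i, ∀ u ∈ W, T i u ∈ W) → W = ⊥ ∨ W = ⊤) ↔
      ∀ m ≤ n, (a + b - (n + 1) + 2 * m + 1) ^ 2 ≠ c ^ 2 ∧
        (a - b - (n + 1) + 2 * m + 1) ^ 2 ≠ c ^ 2 := by
  have hs : Submodule.span F (Set.range w) = ⊤ := by
    rw [← span_range_fin_eq (N := 2 * n + 1 + 1) hw, ← v.span_eq]
    congr 2
    exact funext hv
  have hV : Module.finrank F V = 2 * n + 2 := by simp [Module.finrank_eq_card_basis v]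
  have hfin : FiniteDimensional F V := FiniteDimensional.of_finrank_pos (by omega)
  have hT := h.isDAHARep hs hsum hc
  have hN : w (2 * n + 2) = 0 := hw _ (by omega)
  constructor
  · intro hirr m hm
    constructor
    · intro hρ
      obtain ⟨W, hW, hbot, htop⟩ := h.exists_invariant hs hN hV hm hρ
      exact (hirr W hW).elim hbot htop
    · intro hρ
      obtain ⟨u, hu0, h0, h2⟩ := h.exists_common_eigenvector hs hN hV
      have hl := isEdSeq_ladder hT.neg_b h0 h2
      have hls : Submodule.span F (Set.range (ladder T (n + 1 : F) a u)) = ⊤ := by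
        rw [← span_image_Ici_zero]
        refine (hirr _ (hl.map_mem_span (.inl rfl))).resolve_left fun hbot => hu0 ?_
        rw [← Submodule.mem_bot F, ← hbot]
        exact Submodule.subset_span ⟨0, Set.mem_Ici.2 le_rfl, rfl⟩
      obtain ⟨W, hW, hbot, htop⟩ := hl.exists_invariant hls (ladder_eq_zero h hs hN u) hV hm
        (by rw [← hρ]; ring)
      exact (hirr W hW).elim hbot htop
  · intro hρ W hW
    by_contra! hne
    obtain ⟨hbot, htop⟩ := hne
    have hnot : ∀ u ∈ W, u ≠ 0 → T 0 u = -(n + 1 : F) • u → ∀ β, T 2 u = β • u →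
        β ^ 2 ≠ b ^ 2 := by
      intro u hu hu0 h0 β h2 hβ
      rcases sq_eq_sq_iff_eq_or_eq_neg.1 hβ with rfl | rfl
      · exact htop (h.eq_top_of_mem v hv hw hs (fun m hm => (hρ m hm).1) hT
          (fun m hm => (hρ m hm).1) hW hu hu0 h0 h2)
      · exact htop (h.eq_top_of_mem v hv hw hs (fun m hm => (hρ m hm).1) hT.neg_b
          (fun m hm => by simpa [← sub_eq_add_neg] using (hρ m hm).2) hW hu hu0 h0 h2)
    refine not_reflection_closed n b
      (Λ := fun y => ∃ u ∈ W, u ≠ 0 ∧ (T 0 + T 2) u = y • u) ?_ ?_ ?_ ?_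
    · have : Nontrivial W := Submodule.nontrivial_iff_ne_bot.2 hbot
      have hY : ∀ u ∈ W, (T 0 + T 2) u ∈ W := fun u hu => W.add_mem (hW 0 u hu) (hW 2 u hu)
      obtain ⟨y, hy⟩ := Module.End.exists_eigenvalue ((T 0 + T 2).restrict hY)
      obtain ⟨u, hu⟩ := hy.exists_hasEigenvector
      refine ⟨y, u, u.2, fun h0 => hu.2 (Subtype.ext h0), ?_⟩
      exact congrArg Subtype.val hu.apply_eq_smul
    · rintro y ⟨u, -, hu0, hy⟩
      exact h.eq_ladderEigenvalue hs hw hu0 hy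
    · rintro k hk ⟨u, hu, hu0, hy⟩
      rw [LinearMap.add_apply] at hy
      have hz : T 1 u + T 3 u = -(1 + ladderEigenvalue (n + 1 : F) b k) • u := by
        linear_combination (norm := module) hsum u - hy
      rcases exists_neg_eigenvector_or hT.sq1 hT.sq3 (hW 1) hu hu0 hz with
        ⟨x, hx, hx0, hx1⟩ | ⟨s, -, hs1, hs2⟩
      · refine ⟨x, hx, hx0, ?_⟩
        rw [LinearMap.add_apply]
        linear_combination (norm := module) hsum x - hx1
      · exfalso
        have hk' : ∃ m ≤ n, (1 + ladderEigenvalue (n + 1 : F) b k) =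
            (b - (n + 1) + 2 * m + 1) ∨ 1 + ladderEigenvalue (n + 1 : F) b k =
            -(b - (n + 1) + 2 * m + 1) := by
          obtain ⟨m, rfl | rfl⟩ := Nat.even_or_odd' k
          · exact ⟨m, by omega, .inl (by rw [ladderEigenvalue_even]; ring)⟩
          · exact ⟨m, by omega, .inr (by rw [ladderEigenvalue_odd]; ring)⟩
        obtain ⟨m, hm, hk'⟩ := hk'
        have e1 := (hρ m hm).1
        have e2 := (hρ (n - m) (Nat.sub_le _ _)).2
        rw [Nat.cast_sub hm] at e2
        rcases sq_eq_sq_iff_eq_or_eq_neg.1 hs1 with rfl | rfl <;> rcases hk' with hk' | hk' <;>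
          rw [hk'] at hs2
        · exact e1 (by rw [← hs2]; ring)
        · exact e2 (by rw [← hs2]; ring)
        · exact e2 (by rw [← hs2]; ring)
        · exact e1 (by rw [← hs2]; ring)
    · rintro y ⟨u, hu, hu0, hy⟩
      rcases exists_neg_eigenvector_or hT.sq0 hT.sq2 (hW 0) hu hu0 hy with
        ⟨x, hx, hx0, hx1⟩ | ⟨s, hs0, hs1, hs2⟩
      · exact .inl ⟨x, hx, hx0, hx1⟩
      · right
        rcases sq_eq_sq_iff_eq_or_eq_neg.1 hs1 with rfl | rfl
        · exact hs2
        · refine absurd hs2 (hnot u hu hu0 hs0 _ ?_)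
          rw [LinearMap.add_apply] at hy
          linear_combination (norm := module) hy - hs0

end

theorem forall_smul_mem_of_forall_tGen_smul_mem {F V : Type} [Field F] [AddCommGroup V]
    [Module (DAHAAlg F) V] [Module F V] [IsScalarTower F (DAHAAlg F) V] {W : Submodule F V}
    (hW : ∀ i, ∀ u ∈ W, tGen F i • u ∈ W) (r : DAHAAlg F) : ∀ u ∈ W, r • u ∈ W := by
  obtain ⟨x, rfl⟩ := RingQuot.mkAlgHom_surjective F (DAHARel F) r
  induction x with
  | grade0 r =>
    intro u hu
    rw [AlgHom.commutes, algebraMap_smul]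
    exact W.smul_mem r hu
  | grade1 i => exact hW i
  | mul x y hx hy =>
    intro u hu
    rw [map_mul, mul_smul]
    exact hx _ (hy u hu)
  | add x y hx hy =>
    intro u hu
    rw [map_add, add_smul]
    exact W.add_mem (hx u hu) (hy u hu)

theorem isSimpleModule_dahaAlg_iff {F V : Type} [Field F] [AddCommGroup V]
    [Module (DAHAAlg F) V] [Module F V] [IsScalarTower F (DAHAAlg F) V] [Nontrivial V] :
    IsSimpleModule (DAHAAlg F) V ↔
      ∀ W : Submodule F V, (∀ i, ∀ u ∈ W, tGen F i • u ∈ W) → W = ⊥ ∨ W = ⊤ := by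
  constructor
  · intro _ W hW
    let W' : Submodule (DAHAAlg F) V :=
      { W with smul_mem' := fun r u => forall_smul_mem_of_forall_tGen_smul_mem hW r u }
    refine (eq_bot_or_eq_top W').imp (fun h => ?_) fun h => ?_
    · exact SetLike.coe_injective (congrArg (fun U : Submodule (DAHAAlg F) V => (U : Set V)) h)
    · exact SetLike.coe_injective (congrArg (fun U : Submodule (DAHAAlg F) V => (U : Set V)) h)
  · intro h
    refine (isSimpleModule_iff ..).2 { eq_bot_or_eq_top := fun W => ?_ }
    simpa using h (W.restrictScalars F) fun i u hu => W.smul_mem _ hu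

theorem forall_sq_ne_sq_iff {F : Type} [Field F] (a b c : F) (n : ℕ) :
    (∀ m ≤ n, (a + b - (n + 1) + 2 * m + 1) ^ 2 ≠ c ^ 2 ∧
        (a - b - (n + 1) + 2 * m + 1) ^ 2 ≠ c ^ 2) ↔
      ∀ m ≤ n, a + b + c ≠ (n - 2 * m : F) ∧ -a + b + c ≠ (n - 2 * m : F) ∧
        a - b + c ≠ (n - 2 * m : F) ∧ a + b - c ≠ (n - 2 * m : F) := by
  constructor
  · intro h m hm
    obtain ⟨h1, h2⟩ := h m hm
    have h3 := (h (n - m) (Nat.sub_le _ _)).2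
    rw [Nat.cast_sub hm] at h3
    refine ⟨fun e => h1 ?_, fun e => h3 ?_, fun e => h2 ?_, fun e => h1 ?_⟩
    · linear_combination (a + b - n + 2 * m - c) * e
    · linear_combination -(a - b + n - 2 * m + c) * e
    · linear_combination (a - b - n + 2 * m - c) * e
    · linear_combination (a + b - n + 2 * m + c) * e
  · intro h m hm
    obtain ⟨h1, -, h3, h4⟩ := h m hm
    have h2 := (h (n - m) (Nat.sub_le _ _)).2.1
    rw [Nat.cast_sub hm] at h2
    constructor <;> intro e <;> rcases sq_eq_sq_iff_eq_or_eq_neg.1 e with e | e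
    · exact h4 (by linear_combination e)
    · exact h1 (by linear_combination e)
    · exact h2 (by linear_combination -e)
    · exact h3 (by linear_combination e)

theorem IsEdModule.exists_isEdSeq {F V : Type} [Field F] [CharZero F] [AddCommGroup V]
    [Module (DAHAAlg F) V] [instF : Module F V] [IsScalarTower F (DAHAAlg F) V]
    (hF : instF = resF F (DAHAAlg F) V) {a b c : F} {n : ℕ}
    (hV : IsEdModule F a b c (2 * n + 1) V) :
    ∃ (v : Module.Basis (Fin (2 * n + 1 + 1)) F V) (w : ℕ → V), (∀ i : Fin _, w i = v i) ∧
      (∀ k, 2 * n + 1 < k → w k = 0) ∧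
      IsEdSeq (fun i => opOf F (tGen F i) V) (n + 1 : F) a b c w := by
  subst hF
  let := resF F (DAHAAlg F) V
  obtain ⟨v, w, hv, hw, t0e, t0o, t0z, t0d, t1e, t1o, t1z, t2e, t2o, t2d, t3e, t3o⟩ := hV
  refine ⟨v, w, hv, hw, fun m => ?_, fun m => ?_⟩
  · rcases lt_trichotomy m (n + 1) with hm | rfl | hm
    · have e2 := t2e (2 * m) (by simp) (by omega)
      have e3 := t3e (2 * m) (by simp) (by omega)
      simp only [sigP, tauP] at e3
      push_cast at e3
      refine ⟨?_, ?_, e2, ?_⟩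
      · rcases Nat.eq_zero_or_pos m with rfl | hm0
        · refine t0z.trans ?_
          push_cast
          module
        · refine (t0e (2 * m) (by simp) (by omega) (by omega)).trans ?_
          push_cast
          module
      · rcases Nat.eq_zero_or_pos m with rfl | hm0
        · refine t1z.trans ?_
          simp
        · refine (t1e (2 * m) (by simp) (by omega) (by omega)).trans ?_
          push_cast
          module
      · refine e3.trans ?_
        module
    · have h2 := hw (2 * (n + 1)) (by omega)
      have h3 := hw (2 * (n + 1) + 1) (by omega)
      constructor <;> simp [h2, h3]
    · have h1 := hw (2 * m - 1) (by omega)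
      have h2 := hw (2 * m) (by omega)
      have h3 := hw (2 * m + 1) (by omega)
      constructor <;> simp [h1, h2, h3]
  · rcases lt_or_ge n m with hm | hm
    · have h1 := hw (2 * m) (by omega)
      have h2 := hw (2 * m + 1) (by omega)
      have h3 := hw (2 * m + 2) (by omega)
      constructor <;> simp [h1, h2, h3]
    · have e1 := t1o (2 * m + 1) (by simp) (by omega)
      have e3 := t3o (2 * m + 1) (by simp) (by omega)
      simp only [sigP, tauP, Nat.add_sub_cancel] at e3 t2d t2o
      push_cast at e3
      refine ⟨?_, e1, ?_, ?_⟩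
      · rcases eq_or_lt_of_le hm with rfl | hm
        · refine t0d.trans ?_
          rw [hw (2 * m + 2) (by omega)]
          push_cast
          module
        · refine (t0o (2 * m + 1) (by simp) (by omega)).trans ?_
          push_cast
          module
      · rcases eq_or_lt_of_le hm with rfl | hm
        · refine t2d.trans ?_
          rw [hw (2 * m + 2) (by omega)]
          push_cast
          module
        · refine (t2o (2 * m + 1) (by simp) (by omega)).trans ?_
          push_cast
          module
      · refine e3.trans ?_
        module

/-- For odd `d ≥ 1`, the `𝔥`-module `E_d(a,b,c)` is irreducible iff none
of `a+b+c, -a+b+c, a-b+c, a+b-c` belongs to `{(d-1)/2 - i : i = 0, 2, …, d-1}`. -/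
theorem stmt13 (F : Type) [Field F] [IsAlgClosed F] [CharZero F] (a b c : F) (d : ℕ) (hd : Odd d)
    (V : Type) [AddCommGroup V] [Module (DAHAAlg F) V]
    (hV : IsEdModule F a b c d V) :
    IsSimpleModule (DAHAAlg F) V ↔
      (∀ i : ℕ, Even i → i < d →
        a + b + c ≠ ((d : F) - 1) / 2 - (i : F) ∧
        -a + b + c ≠ ((d : F) - 1) / 2 - (i : F) ∧
        a - b + c ≠ ((d : F) - 1) / 2 - (i : F) ∧
        a + b - c ≠ ((d : F) - 1) / 2 - (i : F)) := by
  obtain ⟨n, rfl⟩ := hd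
  let := resF F (DAHAAlg F) V
  have := resF_tower F (DAHAAlg F) V rfl
  obtain ⟨v, w, hv, hw, h⟩ := hV.exists_isEdSeq rfl
  have : Nontrivial V := ⟨v 0, 0, v.ne_zero 0⟩
  have hsum : ∀ u : V, tGen F 0 • u + tGen F 1 • u + tGen F 2 • u + tGen F 3 • u = -u :=
    fun u => by rw [← add_smul, ← add_smul, ← add_smul, dahaSum, neg_one_smul]
  have hc : ∀ (i j : Fin 4) (u : V),
      tGen F i • tGen F i • tGen F j • u = tGen F j • tGen F i • tGen F i • u :=
    fun i j u => by simp only [← mul_smul, ← mul_assoc, dahaSqCentral]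
  have key := h.forall_invariant_iff v hv hw hsum hc
  rw [isSimpleModule_dahaAlg_iff]
  refine key.trans ((forall_sq_ne_sq_iff a b c n).trans ?_)
  have hn : ∀ m : ℕ, (((2 * n + 1 : ℕ) : F) - 1) / 2 - ((2 * m : ℕ) : F) = n - 2 * m :=
    fun m => by push_cast; ring
  constructor
  · intro H i hi hid
    obtain ⟨m, rfl⟩ := even_iff_exists_two_mul.1 hi
    rw [hn]
    exact H m (by omega)
  · intro H m hm
    rw [← hn]
    exact H (2 * m) (even_two_mul m) (by omega)
end

section
/- Let d ≥ 1 be an odd integer and let V be a (d+1)-dimensional irreducible 𝔥-module. For any a, b, c ∈ F and any ε ∈ {±1}², the following are equivalent: (i) the 𝔥-module E_d(a,b,c)^ε is isomorphic to V; (ii) the trace of t₀ on V^ε is −(d+1) and t₁², t₂², t₃² act on V^ε as scalar multiplication by a², b², c² respectively. -/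
open FreeAlgebra

section QuadraticEndomorphism

variable {F V : Type} [Field F] [AddCommGroup V] [Module F V]

/-- If `t² = k²`, the eigenspaces of `t` for `k` and `-k` have total dimension at least `dim V`. -/
theorem finrank_le_add_finrank_eigenspace_neg [FiniteDimensional F V] {t : Module.End F V} {k : F}
    (h : ∀ u, t (t u) = k ^ 2 • u) :
    Module.finrank F V ≤
      Module.finrank F (t.eigenspace k) + Module.finrank F (t.eigenspace (-k)) := by
  have hk : LinearMap.ker (t + k • 1) = t.eigenspace (-k) := by
    ext u
    rw [Module.End.mem_eigenspace_iff, LinearMap.mem_ker, neg_smul, ← add_eq_zero_iff_eq_neg]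
    rfl
  have hr : LinearMap.range (t + k • 1) ≤ t.eigenspace k := by
    rintro _ ⟨u, rfl⟩
    rw [Module.End.mem_eigenspace_iff]
    change t (t u + k • u) = k • (t u + k • u)
    rw [map_add, map_smul, h]
    module
  have h1 := LinearMap.finrank_range_add_finrank_ker (t + k • 1)
  have h2 := Submodule.finrank_mono hr
  rw [hk] at h1
  omega

/-- If `t² = k²` with `k ≠ 0`, the dimension of the `k`-eigenspace of `t` is determined by the
trace of `t`. -/
theorem two_mul_finrank_eigenspace [FiniteDimensional F V] [CharZero F] {t : Module.End F V}
    {k : F} (hk : k ≠ 0) (h : ∀ u, t (t u) = k ^ 2 • u) :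
    2 * k * (Module.finrank F (t.eigenspace k) : F) =
      LinearMap.trace F V t + Module.finrank F V * k := by
  have hp : LinearMap.IsProj (t.eigenspace k) ((2 * k)⁻¹ • (t + k • (1 : Module.End F V))) := by
    constructor
    · intro u
      rw [Module.End.mem_eigenspace_iff]
      change t ((2 * k)⁻¹ • (t u + k • u)) = k • (2 * k)⁻¹ • (t u + k • u)
      rw [map_smul, map_add, map_smul, h]
      module
    · intro u hu
      rw [Module.End.mem_eigenspace_iff] at hu
      change (2 * k)⁻¹ • (t u + k • u) = u
      rw [hu, ← two_smul F, smul_smul, smul_smul, mul_assoc, inv_mul_cancel₀ (by simpa using hk),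
        one_smul]
  have ht := hp.trace
  rw [map_smul, map_add, map_smul, LinearMap.trace_one, smul_eq_mul, smul_eq_mul] at ht
  rw [← ht]
  field_simp

/-- If `t² = k²`, one of the eigenspaces for `± k` has at least half the dimension. -/
theorem exists_finrank_le_two_mul_eigenspace [FiniteDimensional F V] {t : Module.End F V} {k : F}
    (h : ∀ u, t (t u) = k ^ 2 • u) :
    ∃ x, x ^ 2 = k ^ 2 ∧ Module.finrank F V ≤ 2 * Module.finrank F (t.eigenspace x) := by
  have hn := finrank_le_add_finrank_eigenspace_neg h
  by_cases hx : Module.finrank F V ≤ 2 * Module.finrank F (t.eigenspace k)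
  · exact ⟨k, rfl, hx⟩
  · exact ⟨-k, by ring, by omega⟩

/-- If `t² = k²` and `t` has nonzero trace, one of the eigenspaces for `± k` has more than half
the dimension. -/
theorem exists_finrank_lt_two_mul_eigenspace [FiniteDimensional F V] [CharZero F]
    {t : Module.End F V} {k : F} (h : ∀ u, t (t u) = k ^ 2 • u)
    (ht : LinearMap.trace F V t ≠ 0) :
    ∃ x, x ^ 2 = k ^ 2 ∧ Module.finrank F V < 2 * Module.finrank F (t.eigenspace x) := by
  have hk : k ≠ 0 := by
    rintro rfl
    apply ht
    refine (LinearMap.isNilpotent_trace_of_isNilpotent ⟨2, ?_⟩).eq_zero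
    ext u
    simpa [sq] using h u
  obtain ⟨x, hx, hle⟩ := exists_finrank_le_two_mul_eigenspace h
  refine ⟨x, hx, lt_of_le_of_ne hle fun he => ht ?_⟩
  have hx0 : x ≠ 0 := by
    rintro rfl
    exact hk (by simpa using hx.symm)
  have := two_mul_finrank_eigenspace hx0 (t := t) (by simpa [hx] using h)
  have he' : (Module.finrank F V : F) = 2 * Module.finrank F (t.eigenspace x) := by
    exact_mod_cast he
  rw [he'] at this
  linear_combination -this

/-- Eigenspaces of total dimension greater than `dim V` share an eigenvector. -/
theorem exists_common_eigenvector [FiniteDimensional F V] {s t : Module.End F V} {x y : F}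
    (hx : Module.finrank F V < 2 * Module.finrank F (s.eigenspace x))
    (hy : Module.finrank F V ≤ 2 * Module.finrank F (t.eigenspace y)) :
    ∃ u ≠ 0, s u = x • u ∧ t u = y • u := by
  have h1 := Submodule.finrank_sup_add_finrank_inf_eq (s.eigenspace x) (t.eigenspace y)
  have h2 := Submodule.finrank_le (s.eigenspace x ⊔ t.eigenspace y)
  have h3 : s.eigenspace x ⊓ t.eigenspace y ≠ ⊥ := by
    rw [← Submodule.one_le_finrank_iff]
    omega
  obtain ⟨u, hu, hu0⟩ := Submodule.exists_mem_ne_zero_of_ne_bot h3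
  rw [Submodule.mem_inf, Module.End.mem_eigenspace_iff, Module.End.mem_eigenspace_iff] at hu
  exact ⟨u, hu0, hu⟩

end QuadraticEndomorphism

section Verma

variable {F V : Type} [Field F] [AddCommGroup V] [Module F V]

/-- The relations satisfied by the sequence `v₀, v₁, …` in a Verma type module generated by a
vector `v₀` with `t₀ v₀ = κ v₀` and `t₂ v₀ = b v₀`. The module `E_d(a,b,c)` is the case
`κ = -(d+1)/2` with `v_{d+1} = 0`. -/
structure IsVermaSeq (T : Fin 4 → Module.End F V) (κ a b c : F) (v : ℕ → V) : Prop where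
  zero_zero : T 0 (v 0) = κ • v 0
  zero_odd : ∀ j : ℕ, T 0 (v (2 * j + 1)) =
    -(κ + 2 * (j : F) + 2) • v (2 * j + 1) + v (2 * j + 2)
  zero_even : ∀ j : ℕ, T 0 (v (2 * j + 2)) =
    -((2 * (j : F) + 2) * (2 * κ + 2 * j + 2)) • v (2 * j + 1)
      + (κ + 2 * (j : F) + 2) • v (2 * j + 2)
  one_zero : T 1 (v 0) = a • v 0 + v 1
  one_odd : ∀ j : ℕ, T 1 (v (2 * j + 1)) = -a • v (2 * j + 1)
  one_even : ∀ j : ℕ, T 1 (v (2 * j + 2)) =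
    ((2 * (j : F) + 2) * (2 * κ + 2 * j + 2)) • v (2 * j + 1) + a • v (2 * j + 2) + v (2 * j + 3)
  two_even : ∀ j : ℕ, T 2 (v (2 * j)) = b • v (2 * j)
  two_odd : ∀ j : ℕ, T 2 (v (2 * j + 1)) =
    -((a + b + κ + 2 * (j : F) + 1) ^ 2 - c ^ 2) • v (2 * j) - b • v (2 * j + 1) - v (2 * j + 2)
  three_even : ∀ j : ℕ, T 3 (v (2 * j)) =
    -(a + b + κ + 2 * (j : F) + 1) • v (2 * j) - v (2 * j + 1)
  three_odd : ∀ j : ℕ, T 3 (v (2 * j + 1)) =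
    ((a + b + κ + 2 * (j : F) + 1) ^ 2 - c ^ 2) • v (2 * j)
      + (a + b + κ + 2 * (j : F) + 1) • v (2 * j + 1)

/-- The sequence generated from `u` by the operators `t₀ + t₁ - θᵢ`. -/
def vermaSeq (T : Fin 4 → Module.End F V) (κ a : F) (u : V) : ℕ → V
  | 0 => u
  | i + 1 => T 0 (vermaSeq T κ a u i) + T 1 (vermaSeq T κ a u i)
      - (if Even i then a + κ + i else -κ - i - 1 - a) • vermaSeq T κ a u i

theorem vermaSeq_two_mul_add_one (T : Fin 4 → Module.End F V) (κ a : F) (u : V) (j : ℕ) :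
    vermaSeq T κ a u (2 * j + 1) = T 0 (vermaSeq T κ a u (2 * j))
      + T 1 (vermaSeq T κ a u (2 * j)) - (a + κ + 2 * (j : F)) • vermaSeq T κ a u (2 * j) := by
  rw [vermaSeq, if_pos (even_two_mul j)]
  push_cast
  rfl

theorem vermaSeq_two_mul_add_two (T : Fin 4 → Module.End F V) (κ a : F) (u : V) (j : ℕ) :
    vermaSeq T κ a u (2 * j + 2) = T 0 (vermaSeq T κ a u (2 * j + 1))
      + T 1 (vermaSeq T κ a u (2 * j + 1))
      + (κ + 2 * (j : F) + 2 + a) • vermaSeq T κ a u (2 * j + 1) := by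
  rw [vermaSeq, if_neg (by simp)]
  push_cast
  module

theorem vermaSeq_eq_zero {T : Fin 4 → Module.End F V} {κ a : F} {u : V} {m n : ℕ} (hmn : m ≤ n)
    (h : vermaSeq T κ a u m = 0) : vermaSeq T κ a u n = 0 := by
  induction n, hmn using Nat.le_induction with
  | base => exact h
  | succ k _ ih => simp [vermaSeq, ih]

theorem isVermaSeq_vermaSeq {T : Fin 4 → Module.End F V} {κ a b c : F} {u : V}
    (hsum : ∀ w, T 0 w + T 1 w + T 2 w + T 3 w = -w)
    (h0 : ∀ w, T 0 (T 0 w) = κ ^ 2 • w) (h1 : ∀ w, T 1 (T 1 w) = a ^ 2 • w)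
    (h2 : ∀ w, T 2 (T 2 w) = b ^ 2 • w) (h3 : ∀ w, T 3 (T 3 w) = c ^ 2 • w)
    (hu0 : T 0 u = κ • u) (hu2 : T 2 u = b • u) :
    IsVermaSeq T κ a b c (vermaSeq T κ a u) := by
  have e1 := vermaSeq_two_mul_add_one T κ a u
  have e2 := vermaSeq_two_mul_add_two T κ a u
  have v0 : vermaSeq T κ a u 0 = u := rfl
  generalize vermaSeq T κ a u = v at e1 e2 v0 ⊢
  subst v0
  -- one step: the action on `y = v_{2j+1}` and `z = v_{2j+2}` from that on `x = v_{2j}`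
  have odd_one : ∀ (p x y : V) (r e : F), r • (T 1 p + a • p) = 0 →
      T 0 x = -r • p + e • x → y = T 0 x + T 1 x - (a + e) • x → T 1 y = -a • y := by
    intro p x y r e hp hx hy
    have hy' : y = T 1 x - a • x - r • p := by rw [hy, hx]; module
    rw [hy']
    simp only [map_sub, map_smul, h1]
    linear_combination (norm := module) -hp
  have odd_three : ∀ (x y : V) (e : F), T 2 x = b • x → y = T 0 x + T 1 x - (a + e) • x →
      T 3 x = -(a + b + e + 1) • x - y := by
    intro x y e hx hy
    linear_combination (norm := module) hsum x - hx + hy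
  have odd_three' : ∀ (x y : V) (s : F), T 3 x = -s • x - y →
      T 3 y = (s ^ 2 - c ^ 2) • x + s • y := by
    intro x y s hx
    have hy : y = -T 3 x - s • x := by rw [hx]; module
    have h := h3 x
    rw [hx] at h
    simp only [map_sub, map_smul, hx] at h
    linear_combination (norm := module) -h
  have even_zero : ∀ (y z : V) (i : F), T 1 y = -a • y → z = T 0 y + T 1 y + (κ + i + a) • y →
      T 0 y = -(κ + i) • y + z ∧ T 0 z = -(i * (2 * κ + i)) • y + (κ + i) • z := by
    intro y z i hy hz
    have hy0 : T 0 y = -(κ + i) • y + z := by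
      linear_combination (norm := module) -hz - hy
    refine ⟨hy0, ?_⟩
    have h := h0 y
    rw [hy0] at h
    simp only [map_add, map_smul, hy0] at h
    linear_combination (norm := module) h
  have even_two : ∀ (x y z : V) (r : F), T 2 x = b • x → T 2 y = -r • x - b • y - z →
      T 2 z = b • z := by
    intro x y z r hx hy
    have h := h2 y
    rw [hy] at h
    simp only [map_sub, map_smul, hx, hy] at h
    linear_combination (norm := module) -h
  have two_odd : ∀ (x y z : V) (s i : F), T 1 y = -a • y → T 0 y = -(κ + i) • y + z →
      s = a + b + κ + i - 1 → T 3 y = (s ^ 2 - c ^ 2) • x + s • y →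
      T 2 y = -(s ^ 2 - c ^ 2) • x - b • y - z := by
    intro x y z s i hy1 hy0 hs hy3
    have h := hsum y
    rw [hy1, hy0, hy3, hs] at h
    rw [hs]
    linear_combination (norm := module) h
  have main : ∀ j : ℕ, ∃ (p : V) (r : F), r • (T 1 p + a • p) = 0 ∧
      T 0 (v (2 * j)) = -r • p + (κ + 2 * (j : F)) • v (2 * j) ∧
      T 2 (v (2 * j)) = b • v (2 * j) := by
    intro j
    induction j with
    | zero => exact ⟨0, 0, by simp, by simpa using hu0, hu2⟩
    | succ j ih =>
      obtain ⟨p, r, hp, hx0, hx2⟩ := ih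
      have hy : v (2 * j + 1) = T 0 (v (2 * j)) + T 1 (v (2 * j))
          - (a + (κ + 2 * (j : F))) • v (2 * j) := by rw [e1]; module
      have hy1 := odd_one _ _ _ _ _ hp hx0 hy
      have hx3 := odd_three _ _ _ hx2 hy
      have hy3 := odd_three' _ _ _ hx3
      have hz : v (2 * j + 2) = T 0 (v (2 * j + 1)) + T 1 (v (2 * j + 1))
          + (κ + (2 * (j : F) + 2) + a) • v (2 * j + 1) := by rw [e2]; module
      obtain ⟨hy0, hz0⟩ := even_zero _ _ _ hy1 hz
      have hy2 := two_odd _ _ _ _ _ hy1 hy0 (by ring) hy3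
      have hz2 := even_two _ _ _ _ hx2 hy2
      refine ⟨v (2 * j + 1), (2 * (j : F) + 2) * (2 * κ + (2 * j + 2)), by rw [hy1]; module, ?_,
        hz2⟩
      change T 0 (v (2 * j + 2)) = _ + _ • v (2 * j + 2)
      rw [hz0]
      push_cast
      module
  have hy1 : ∀ j : ℕ, T 1 (v (2 * j + 1)) = -a • v (2 * j + 1) := by
    intro j
    obtain ⟨p, r, hp, hx0, hx2⟩ := main j
    exact odd_one _ _ _ _ _ hp hx0 (by rw [e1]; module)
  have hz : ∀ j : ℕ, v (2 * j + 2) = T 0 (v (2 * j + 1)) + T 1 (v (2 * j + 1))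
      + (κ + (2 * (j : F) + 2) + a) • v (2 * j + 1) := by intro j; rw [e2]; module
  have hy0 := fun j => (even_zero _ _ _ (hy1 j) (hz j)).1
  have hz0 := fun j => (even_zero _ _ _ (hy1 j) (hz j)).2
  have hx2 : ∀ j : ℕ, T 2 (v (2 * j)) = b • v (2 * j) :=
    fun j => (main j).choose_spec.choose_spec.2.2
  have hx3 : ∀ j : ℕ, T 3 (v (2 * j)) =
      -(a + b + κ + 2 * (j : F) + 1) • v (2 * j) - v (2 * j + 1) := by
    intro j
    rw [odd_three (v (2 * j)) (v (2 * j + 1)) (κ + 2 * (j : F)) (hx2 j) (by rw [e1]; module)]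
    module
  have hy3 := fun j => odd_three' _ _ _ (hx3 j)
  refine ⟨hu0, fun j => ?_, fun j => ?_, ?_, hy1, fun j => ?_, hx2, fun j => ?_, hx3, hy3⟩
  · rw [hy0]; module
  · rw [hz0]; module
  · have h := e1 0
    rw [Nat.mul_zero, hu0] at h
    rw [h, Nat.cast_zero]
    module
  · have h := e1 (j + 1)
    change v (2 * j + 3) = T 0 (v (2 * j + 2)) + T 1 (v (2 * j + 2)) - _ • v (2 * j + 2) at h
    rw [hz0] at h
    rw [h]
    push_cast
    module
  · exact two_odd _ _ _ _ (2 * (j : F) + 2) (hy1 j) (hy0 j) (by ring) (hy3 j)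

/-- In an irreducible module, the initial segment of a nonzero Verma sequence is a basis. -/
theorem IsVermaSeq.exists_basis {T : Fin 4 → Module.End F V} {κ a b c : F} {v : ℕ → V}
    (h : IsVermaSeq T κ a b c v)
    (hirr : ∀ W : Submodule F V, (∀ i, ∀ w ∈ W, T i w ∈ W) → W = ⊥ ∨ W = ⊤)
    (hv : v 0 ≠ 0) {n : ℕ} [NeZero n] (hn : Module.finrank F V = n) :
    ∃ B : Module.Basis (Fin n) F V, ∀ i : Fin n, B i = v i := by
  have hli : ∀ k ≤ n, LinearIndependent F (fun i : Fin k => v i) := by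
    intro k
    induction k with
    | zero => exact fun _ => linearIndependent_empty_type
    | succ k ih =>
      intro hk
      rw [linearIndependent_finSucc']
      refine ⟨ih (by omega), fun hmem => ?_⟩
      change v k ∈ Submodule.span F (Set.range fun i : Fin k => v i) at hmem
      set W := Submodule.span F (Set.range fun i : Fin k => v i) with hW
      have hvW : ∀ m ≤ k, v m ∈ W := by
        intro m hm
        rcases hm.eq_or_lt with rfl | hm
        · exact hmem
        · exact Submodule.subset_span ⟨⟨m, hm⟩, rfl⟩
      have hgen : ∀ i : Fin 4, ∀ m < k, T i (v m) ∈ W := by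
        intro i m hm
        have hm1 := hvW m hm.le
        have hm2 := hvW (m + 1) hm
        obtain ⟨j, rfl | rfl⟩ := m.even_or_odd'
        · rcases j with _ | j
          · have h2 := h.two_even 0
            have h3 := h.three_even 0
            simp only [mul_zero, zero_add] at hm1 hm2 h2 h3
            fin_cases i
            · exact h.zero_zero ▸ W.smul_mem _ hm1
            · exact h.one_zero ▸ W.add_mem (W.smul_mem _ hm1) hm2
            · exact h2 ▸ W.smul_mem _ hm1
            · exact h3 ▸ W.sub_mem (W.smul_mem _ hm1) hm2
          · have hm0 := hvW (2 * j + 1) (by omega)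
            fin_cases i
            · exact h.zero_even j ▸ W.add_mem (W.smul_mem _ hm0) (W.smul_mem _ hm1)
            · exact h.one_even j ▸
                W.add_mem (W.add_mem (W.smul_mem _ hm0) (W.smul_mem _ hm1)) hm2
            · exact h.two_even (j + 1) ▸ W.smul_mem _ hm1
            · exact h.three_even (j + 1) ▸ W.sub_mem (W.smul_mem _ hm1) hm2
        · have hm0 := hvW (2 * j) (by omega)
          fin_cases i
          · exact h.zero_odd j ▸ W.add_mem (W.smul_mem _ hm1) hm2
          · exact h.one_odd j ▸ W.smul_mem _ hm1
          · exact h.two_odd j ▸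
              W.sub_mem (W.sub_mem (W.smul_mem _ hm0) (W.smul_mem _ hm1)) hm2
          · exact h.three_odd j ▸ W.add_mem (W.smul_mem _ hm0) (W.smul_mem _ hm1)
      have hinv : ∀ i, ∀ w ∈ W, T i w ∈ W := by
        intro i
        change W ≤ W.comap (T i)
        conv_lhs => rw [hW]
        rw [Submodule.span_le]
        rintro _ ⟨m, rfl⟩
        exact hgen i m m.isLt
      rcases hirr W hinv with hbot | htop
      · exact hv (by simpa [hbot] using hvW 0 k.zero_le)
      · have hle := finrank_range_le_card (R := F) (fun i : Fin k => v i)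
        rw [Set.finrank, ← hW, htop, finrank_top, hn, Fintype.card_fin] at hle
        omega
  refine ⟨basisOfLinearIndependentOfCardEqFinrank (hli n le_rfl) (by simp [hn]), fun i => ?_⟩
  simp

theorem coord_basis_nat {n : ℕ} (B : Module.Basis (Fin n) F V) {v : ℕ → V}
    (hB : ∀ i : Fin n, B i = v i) (i : Fin n) {m : ℕ} (hm : m < n) :
    B.repr (v m) i = if m = i then 1 else 0 := by
  have := hB ⟨m, hm⟩
  simp only at this
  simp [← this, Finsupp.single_apply, Fin.ext_iff]

theorem trace_eq_sum_coord {n : ℕ} (B : Module.Basis (Fin n) F V) {v : ℕ → V}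
    (hB : ∀ i : Fin n, B i = v i) (f : Module.End F V) (g : ℕ → F)
    (hg : ∀ i : Fin n, B.repr (f (v i)) i = g i) :
    LinearMap.trace F V f = ∑ i ∈ Finset.range n, g i := by
  rw [LinearMap.trace_eq_matrix_trace F B, Matrix.trace, ← Fin.sum_univ_eq_sum_range]
  refine Finset.sum_congr rfl fun i _ => ?_
  rw [Matrix.diag_apply, LinearMap.toMatrix_apply, hB, hg]

theorem sum_range_two_mul_eq_zero (g : ℕ → F) (m : ℕ)
    (h : ∀ j < m, g (2 * j) + g (2 * j + 1) = 0) : ∑ i ∈ Finset.range (2 * m), g i = 0 := by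
  induction m with
  | zero => simp
  | succ m ih =>
    rw [mul_add, mul_one, Finset.sum_range_succ, Finset.sum_range_succ,
      ih fun j hj => h j (by omega), zero_add, h m (by omega)]

variable {T : Fin 4 → Module.End F V} {κ a b c : F} {v : ℕ → V} {m : ℕ}

theorem IsVermaSeq.trace_one (h : IsVermaSeq T κ a b c v)
    (B : Module.Basis (Fin (2 * m + 2)) F V) (hB : ∀ i : Fin (2 * m + 2), B i = v i) :
    LinearMap.trace F V (T 1) = 0 := by
  have hc := fun i m hm => coord_basis_nat B hB i (m := m) hm
  rw [trace_eq_sum_coord B hB (T 1) (fun i => if Even i then a else -a)]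
  · exact sum_range_two_mul_eq_zero _ (m + 1) fun j _ => by simp
  · rintro ⟨i, hi⟩
    obtain ⟨j, rfl | rfl⟩ := i.even_or_odd'
    · rcases j with _ | j
      · simp [h.one_zero, hc 0 0 (by omega), hc 0 1 (by omega)]
      · change B.repr (T 1 (v (2 * j + 2))) ⟨2 * j + 2, hi⟩ = _
        simp [h.one_even, hc _ (2 * j + 1) (by omega), hc _ (2 * j + 2) (by omega),
          hc _ (2 * j + 3) (by omega)]
    · simp [h.one_odd, hc _ (2 * j + 1) (by omega)]

theorem IsVermaSeq.trace_three (h : IsVermaSeq T κ a b c v)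
    (B : Module.Basis (Fin (2 * m + 2)) F V) (hB : ∀ i : Fin (2 * m + 2), B i = v i) :
    LinearMap.trace F V (T 3) = 0 := by
  have hc := fun i m hm => coord_basis_nat B hB i (m := m) hm
  rw [trace_eq_sum_coord B hB (T 3)
    (fun i => if Even i then -(a + b + κ + i + 1) else a + b + κ + i)]
  · exact sum_range_two_mul_eq_zero _ (m + 1) fun j _ => by simp; ring
  · rintro ⟨i, hi⟩
    obtain ⟨j, rfl | rfl⟩ := i.even_or_odd'
    · simp [h.three_even, hc _ (2 * j) (by omega), hc _ (2 * j + 1) (by omega)]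
    · simp [h.three_odd, hc _ (2 * j) (by omega), hc _ (2 * j + 1) (by omega)]
      ring

theorem IsVermaSeq.trace_zero (h : IsVermaSeq T κ a b c v)
    (B : Module.Basis (Fin (2 * m + 2)) F V) (hB : ∀ i : Fin (2 * m + 2), B i = v i) :
    LinearMap.trace F V (T 0) =
      κ + B.repr (T 0 (v (2 * m + 1))) (Fin.last (2 * m + 1)) := by
  have hc := fun i m hm => coord_basis_nat B hB i (m := m) hm
  have hs : ∑ i ∈ Finset.range (2 * m),
      (if Even i then -(κ + i + 2) else (κ + i + 1) : F) = 0 :=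
    sum_range_two_mul_eq_zero _ m fun j _ => by simp; ring
  rw [trace_eq_sum_coord B hB (T 0)
    (fun i => if i = 0 then κ else if i = 2 * m + 1 then
      B.repr (T 0 (v (2 * m + 1))) (Fin.last (2 * m + 1)) else
      if Even (i - 1) then -(κ + (i - 1 : ℕ) + 2) else κ + (i - 1 : ℕ) + 1)]
  · rw [Finset.sum_range_succ, Finset.sum_range_succ', Finset.sum_congr rfl (g := fun i : ℕ =>
      (if Even i then -(κ + i + 2) else (κ + i + 1) : F)), hs]
    · simp
    · intro i hi
      have : i ≠ 2 * m := by have := Finset.mem_range.1 hi; omega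
      simp [this]
  · rintro ⟨i, hi⟩
    obtain ⟨j, rfl | rfl⟩ := i.even_or_odd'
    · rcases j with _ | j
      · simp [h.zero_zero, hc 0 0 (by omega)]
      · change B.repr (T 0 (v (2 * j + 2))) ⟨2 * j + 2, hi⟩ = _
        have : 2 * (j + 1) ≠ 2 * m + 1 := by omega
        have h1 : 2 * (j + 1) - 1 = 2 * j + 1 := by omega
        simp [h.zero_even, hc _ (2 * j + 1) (by omega), hc _ (2 * j + 2) (by omega), this, h1]
        ring
    · by_cases hj : j = m
      · subst hj
        simp
        rfl
      · simp [h.zero_odd, hc _ (2 * j + 1) (by omega), hc _ (2 * j + 2) (by omega), hj]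

/-- The trace of `t₀` is the sum of the eigenvalue `κ` and another eigenvalue. -/
theorem IsVermaSeq.exists_trace_zero_eq_add (h : IsVermaSeq T κ a b c v)
    (h0 : ∀ w, T 0 (T 0 w) = κ ^ 2 • w)
    (B : Module.Basis (Fin (2 * m + 2)) F V) (hB : ∀ i : Fin (2 * m + 2), B i = v i) :
    ∃ x, x ^ 2 = κ ^ 2 ∧ LinearMap.trace F V (T 0) = κ + x := by
  have hc := fun i m hm => coord_basis_nat B hB i (m := m) hm
  refine ⟨_, ?_, h.trace_zero B hB⟩
  set x := B.repr (T 0 (v (2 * m + 1))) (Fin.last (2 * m + 1)) with hx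
  have hf : B.coord (Fin.last (2 * m + 1)) ∘ₗ T 0 = x • B.coord (Fin.last (2 * m + 1)) := by
    refine B.ext fun i => ?_
    obtain ⟨i, hi⟩ := i
    simp only [LinearMap.comp_apply, LinearMap.smul_apply, Module.Basis.coord_apply, hB]
    obtain ⟨j, rfl | rfl⟩ := i.even_or_odd'
    · rcases j with _ | j
      · simp [h.zero_zero, hc _ 0 (by omega)]
      · change B.repr (T 0 (v (2 * j + 2))) _ = x • B.repr (v (2 * j + 2)) _
        have h1 : j ≠ m := by omega
        have h2 : 2 * j + 1 ≠ 2 * m := by omega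
        simp [h.zero_even, hc _ (2 * j + 1) (by omega), hc _ (2 * j + 2) (by omega), h1, h2]
    · by_cases hj : j = m
      · subst hj
        simp [hc _ (2 * j + 1) (by omega), hx]
      · have h2 : 2 * j + 1 ≠ 2 * m := by omega
        simp [h.zero_odd, hc _ (2 * j + 1) (by omega), hc _ (2 * j + 2) (by omega), hj, h2]
  have hf' := fun w => LinearMap.congr_fun hf w
  simp only [LinearMap.comp_apply, LinearMap.smul_apply, Module.Basis.coord_apply] at hf'
  have h2 := hf' (T 0 (v (2 * m + 1)))
  rw [h0, hf', map_smul, Finsupp.smul_apply, hc _ (2 * m + 1) (by omega)] at h2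
  simp only [Fin.val_last, if_true, smul_eq_mul, mul_one] at h2
  rw [h2, sq]

theorem IsVermaSeq.one_one (h : IsVermaSeq T κ a b c v) (n : ℕ) :
    T 1 (T 1 (v n)) = a ^ 2 • v n := by
  obtain ⟨j, rfl | rfl⟩ := n.even_or_odd'
  · rcases j with _ | j
    · rw [mul_zero, h.one_zero, map_add, map_smul, h.one_zero, h.one_odd 0]
      module
    · change T 1 (T 1 (v (2 * j + 2))) = _ • v (2 * j + 2)
      have h3 : T 1 (v (2 * j + 3)) = -a • v (2 * j + 3) := h.one_odd (j + 1)
      simp only [h.one_even, map_add, map_smul, h.one_odd, h3]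
      module
  · simp only [h.one_odd, map_smul]
    module

theorem IsVermaSeq.two_two (h : IsVermaSeq T κ a b c v) (n : ℕ) :
    T 2 (T 2 (v n)) = b ^ 2 • v n := by
  obtain ⟨j, rfl | rfl⟩ := n.even_or_odd'
  · simp only [h.two_even, map_smul]
    module
  · have h2 : T 2 (v (2 * j + 2)) = b • v (2 * j + 2) := h.two_even (j + 1)
    simp only [h.two_odd, map_sub, map_smul, h.two_even, h2]
    module

theorem IsVermaSeq.three_three (h : IsVermaSeq T κ a b c v) (n : ℕ) :
    T 3 (T 3 (v n)) = c ^ 2 • v n := by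
  obtain ⟨j, rfl | rfl⟩ := n.even_or_odd' <;>
  · simp only [h.three_odd, h.three_even, map_add, map_sub, map_smul]
    module

/-- An irreducible module of dimension `2m+2` on which `t₀` has trace `-(2m+2)` has a basis that
is a Verma sequence terminating after `2m+2` terms. -/
theorem exists_basis_isVermaSeq [CharZero F] {k : F}
    (hirr : ∀ W : Submodule F V, (∀ i, ∀ w ∈ W, T i w ∈ W) → W = ⊥ ∨ W = ⊤)
    (hdim : Module.finrank F V = 2 * m + 2)
    (hsum : ∀ w, T 0 w + T 1 w + T 2 w + T 3 w = -w)
    (h0 : ∀ w, T 0 (T 0 w) = k ^ 2 • w) (h1 : ∀ w, T 1 (T 1 w) = a ^ 2 • w)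
    (h2 : ∀ w, T 2 (T 2 w) = b ^ 2 • w) (h3 : ∀ w, T 3 (T 3 w) = c ^ 2 • w)
    (htr : LinearMap.trace F V (T 0) = -(2 * m + 2)) :
    ∃ (B : Module.Basis (Fin (2 * m + 2)) F V) (v : ℕ → V), (∀ i : Fin (2 * m + 2), B i = v i) ∧
      (∀ n, 2 * m + 1 < n → v n = 0) ∧ IsVermaSeq T (-((m : F) + 1)) a b c v := by
  have : FiniteDimensional F V := Module.finite_of_finrank_pos (by omega)
  have hm : (m : F) + 1 ≠ 0 := by exact_mod_cast m.succ_ne_zero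
  have hm2 : (2 * m + 2 : F) ≠ 0 := by
    intro h
    exact hm (by linear_combination h / 2)
  -- a common eigenvector of `t₀` and `t₂` starts a basis that is a Verma sequence
  have key : ∀ (x y : F) (u : V), x ^ 2 = k ^ 2 → y ^ 2 = b ^ 2 → u ≠ 0 → T 0 u = x • u →
      T 2 u = y • u → x = -((m : F) + 1) ∧ LinearMap.trace F V (T 2) = 0 ∧
      IsVermaSeq T x a y c (vermaSeq T x a u) ∧
      ∃ B : Module.Basis (Fin (2 * m + 2)) F V,
        ∀ i : Fin (2 * m + 2), B i = vermaSeq T x a u i := by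
    intro x y u hx hy hu hu0 hu2
    have h0' : ∀ w, T 0 (T 0 w) = x ^ 2 • w := by simpa only [hx] using h0
    have hV : IsVermaSeq T x a y c (vermaSeq T x a u) :=
      isVermaSeq_vermaSeq hsum h0' h1 (by simpa only [hy] using h2) h3 hu0 hu2
    obtain ⟨B, hB⟩ := hV.exists_basis hirr hu hdim
    obtain ⟨x', hx', ht⟩ := hV.exists_trace_zero_eq_add h0' B hB
    refine ⟨?_, ?_, hV, B, hB⟩
    · rw [htr] at ht
      rcases sq_eq_sq_iff_eq_or_eq_neg.1 hx' with rfl | rfl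
      · linear_combination -ht / 2
      · exact absurd (by linear_combination -ht) hm2
    · have hs : T 0 + T 1 + T 2 + T 3 = (-1 : F) • 1 := by
        ext w
        simpa using hsum w
      have hs' := congrArg (LinearMap.trace F V) hs
      simp only [map_add, map_smul, hV.trace_one B hB, hV.trace_three B hB, htr,
        LinearMap.trace_one, hdim] at hs'
      push_cast at hs'
      linear_combination hs'
  obtain ⟨x, hx, hx'⟩ := exists_finrank_lt_two_mul_eigenspace h0
    (by rw [htr]; exact neg_ne_zero.2 hm2)
  obtain ⟨y, hy, hy'⟩ := exists_finrank_le_two_mul_eigenspace h2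
  obtain ⟨u, hu, hu0, hu2⟩ := exists_common_eigenvector hx' hy'
  obtain ⟨rfl, htr2, -⟩ := key x y u hx hy hu hu0 hu2
  have hb : Module.finrank F V ≤ 2 * Module.finrank F ((T 2).eigenspace b) := by
    rcases sq_eq_sq_iff_eq_or_eq_neg.1 hy with rfl | rfl
    · exact hy'
    · by_cases hb0 : b = 0
      · rwa [hb0, neg_zero, ← hb0] at hy'
      · have := two_mul_finrank_eigenspace hb0 h2
        rw [htr2, zero_add, mul_assoc, mul_left_comm, mul_comm _ b] at this
        exact (Nat.cast_injective (R := F) (by simpa using mul_left_cancel₀ hb0 this)).ge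
  obtain ⟨u, hu, hu0, hu2⟩ := exists_common_eigenvector hx' hb
  obtain ⟨-, -, hV, B, hB⟩ := key _ b u hx rfl hu hu0 hu2
  refine ⟨B, _, hB, fun n hn => vermaSeq_eq_zero (Nat.succ_le_of_lt hn) ?_, hV⟩
  by_contra hne
  have e0 : T 0 (vermaSeq T (-((m : F) + 1)) a u (2 * m + 2)) =
      ((m : F) + 1) • vermaSeq T (-((m : F) + 1)) a u (2 * m + 2) := by
    rw [hV.zero_even]
    module
  obtain ⟨he, -⟩ := key _ b _ (by rw [← hx]; ring) rfl hne e0 (hV.two_even (m + 1))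
  exact hm2 (by linear_combination he)

end Verma

section DAHAModule

variable {F : Type} [Field F]

/-- The generator `tᵢ` of `𝔥` acting on a module. -/
def tOp (F : Type) [Field F] (V : Type) [AddCommGroup V] [Module F V] [Module (DAHAAlg F) V]
    [IsScalarTower F (DAHAAlg F) V] (i : Fin 4) : Module.End F V :=
  opOf F (tGen F i) V

variable {V : Type} [AddCommGroup V] [Module F V] [Module (DAHAAlg F) V]
    [IsScalarTower F (DAHAAlg F) V]

theorem tOp_apply (i : Fin 4) (u : V) : tOp F V i u = tGen F i • u := rfl

theorem sum_tOp (u : V) :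
    tOp F V 0 u + tOp F V 1 u + tOp F V 2 u + tOp F V 3 u = -u := by
  simp only [tOp_apply, ← add_smul, dahaSum, neg_smul, one_smul]

theorem smul_mem_of_forall_tOp_mem {W : Submodule F V}
    (hW : ∀ i, ∀ w ∈ W, tOp F V i w ∈ W) (x : DAHAAlg F) {w : V} (hw : w ∈ W) :
    x • w ∈ W := by
  obtain ⟨x, rfl⟩ := RingQuot.mkAlgHom_surjective F (DAHARel F) x
  induction x generalizing w with
  | grade0 r => rw [AlgHom.commutes, algebraMap_smul]; exact W.smul_mem r hw
  | grade1 i => exact hW i w hw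
  | mul x y hx hy => rw [map_mul, mul_smul]; exact hx (hy hw)
  | add x y hx hy => rw [map_add, add_smul]; exact W.add_mem (hx hw) (hy hw)

theorem eq_bot_or_eq_top_of_forall_tOp_mem [IsSimpleModule (DAHAAlg F) V] (W : Submodule F V)
    (hW : ∀ i, ∀ w ∈ W, tOp F V i w ∈ W) : W = ⊥ ∨ W = ⊤ := by
  let W' : Submodule (DAHAAlg F) V :=
    { W with smul_mem' := fun x _ hw => smul_mem_of_forall_tOp_mem hW x hw }
  have hW' : ∀ u, u ∈ W' ↔ u ∈ W := fun _ => Iff.rfl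
  refine (eq_bot_or_eq_top W').imp (fun h => ?_) (fun h => ?_) <;>
  · ext u
    rw [← hW', h]
    simp

/-- Schur's lemma for the central elements `tᵢ²`. -/
theorem exists_tOp_tOp_eq_sq_smul [IsAlgClosed F] [FiniteDimensional F V]
    [IsSimpleModule (DAHAAlg F) V] (i : Fin 4) :
    ∃ k : F, ∀ u, tOp F V i (tOp F V i u) = k ^ 2 • u := by
  have : Nontrivial V := IsSimpleModule.nontrivial (DAHAAlg F) V
  obtain ⟨μ, hμ⟩ := Module.End.exists_eigenvalue (tOp F V i * tOp F V i)
  obtain ⟨k, rfl⟩ := IsAlgClosed.exists_pow_nat_eq μ (n := 2) (by norm_num)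
  refine ⟨k, fun u => ?_⟩
  have hinv : ∀ j, ∀ w ∈ (tOp F V i * tOp F V i).eigenspace (k ^ 2),
      tOp F V j w ∈ (tOp F V i * tOp F V i).eigenspace (k ^ 2) := by
    intro j w hw
    rw [Module.End.mem_eigenspace_iff] at hw ⊢
    rw [← map_smul, ← hw]
    simp only [Module.End.mul_apply, tOp_apply, ← mul_smul, ← mul_assoc]
    rw [dahaSqCentral, mul_assoc]
  have htop := (eq_bot_or_eq_top_of_forall_tOp_mem _ hinv).resolve_left hμ
  have hu : u ∈ (tOp F V i * tOp F V i).eigenspace (k ^ 2) := htop ▸ Submodule.mem_top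
  exact Module.End.mem_eigenspace_iff.1 hu

end DAHAModule

section Ed

variable {F : Type} [Field F] {V : Type} [AddCommGroup V] [Module (DAHAAlg F) V]

theorem isEdModule_iff_isVermaSeq [CharZero F] (a b c : F) (m : ℕ) :
    letI := resF F (DAHAAlg F) V
    haveI := resF_tower F (DAHAAlg F) V rfl
    IsEdModule F a b c (2 * m + 1) V ↔
      ∃ (B : Module.Basis (Fin (2 * m + 2)) F V) (v : ℕ → V),
        (∀ i : Fin (2 * m + 2), B i = v i) ∧ (∀ n, 2 * m + 1 < n → v n = 0) ∧
        IsVermaSeq (tOp F V) (-((m : F) + 1)) a b c v := by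
  let := resF F (DAHAAlg F) V
  have := resF_tower F (DAHAAlg F) V rfl
  constructor
  · rintro ⟨B, v, hB, hv, h0e, h0o, h00, h0d, h1e, h1o, h10, h2e, h2o, h2d, h3e, h3o⟩
    refine ⟨B, v, fun i => (hB i).symm, hv, ?_⟩
    have htail : ∀ j, m < j → v (2 * j) = 0 ∧ v (2 * j + 1) = 0 ∧ v (2 * j + 2) = 0 :=
      fun j hj => ⟨hv _ (by omega), hv _ (by omega), hv _ (by omega)⟩
    have htop : v (2 * m + 2) = 0 ∧ v (2 * m + 3) = 0 := ⟨hv _ (by omega), hv _ (by omega)⟩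
    constructor
    · rw [tOp_apply, h00]
      push_cast
      module
    · intro j
      rw [tOp_apply]
      rcases lt_trichotomy j m with hj | rfl | hj
      · rw [h0o (2 * j + 1) (by simp) (by omega)]
        push_cast
        module
      · rw [h0d, htop.1]
        push_cast
        module
      · simp [htail j hj]
    · intro j
      rw [tOp_apply]
      rcases lt_trichotomy j m with hj | rfl | hj
      · rw [h0e (2 * j + 2) (by simp [Nat.even_add]) (by omega) (by omega)]
        push_cast
        module
      · rw [htop.1, smul_zero]
        module
      · simp [htail j hj]
    · exact h10
    · intro j
      rw [tOp_apply]
      rcases le_or_gt j m with hj | hj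
      · exact h1o _ (by simp) (by omega)
      · simp [htail j hj]
    · intro j
      rw [tOp_apply]
      rcases lt_trichotomy j m with hj | rfl | hj
      · rw [h1e (2 * j + 2) (by simp [Nat.even_add]) (by omega) (by omega)]
        push_cast
        module
      · rw [htop.1, htop.2, smul_zero]
        module
      · simp [htail j hj, hv (2 * j + 3) (by omega)]
    · intro j
      rw [tOp_apply]
      rcases le_or_gt j m with hj | hj
      · exact h2e _ (by simp) (by omega)
      · simp [htail j hj]
    · intro j
      rw [tOp_apply]
      rcases lt_trichotomy j m with hj | rfl | hj
      · rw [h2o (2 * j + 1) (by simp) (by omega), sigP, tauP]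
        push_cast
        module
      · rw [h2d, htop.1, sigP, tauP]
        push_cast
        module
      · simp [htail j hj]
    · intro j
      rw [tOp_apply]
      rcases le_or_gt j m with hj | hj
      · rw [h3e _ (by simp) (by omega), sigP, tauP]
        push_cast
        module
      · simp [htail j hj]
    · intro j
      rw [tOp_apply]
      rcases le_or_gt j m with hj | hj
      · rw [h3o _ (by simp) (by omega), sigP, tauP]
        push_cast
        module
      · simp [htail j hj]
  · rintro ⟨B, v, hB, hv, h⟩
    have hodd : ∀ i : ℕ, Odd i → ∃ j, i = 2 * j + 1 := fun i hi => hi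
    have heven : ∀ i : ℕ, Even i → ∃ j, i = 2 * j := fun i hi => hi.two_dvd
    have heven2 : ∀ i : ℕ, Even i → 2 ≤ i → ∃ j, i = 2 * j + 2 := by
      intro i hi hi2
      obtain ⟨j, rfl⟩ := hi.two_dvd
      exact ⟨j - 1, by omega⟩
    refine ⟨B, v, fun i => (hB i).symm, hv, ?_, ?_, ?_, ?_, ?_, ?_, ?_, ?_, ?_, ?_, ?_, ?_⟩
    · intro i hi hi2 _
      obtain ⟨j, rfl⟩ := heven2 i hi hi2
      rw [← tOp_apply, h.zero_even]
      push_cast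
      module
    · intro i hi _
      obtain ⟨j, rfl⟩ := hodd i hi
      rw [← tOp_apply, h.zero_odd]
      push_cast
      module
    · rw [← tOp_apply, h.zero_zero]
      push_cast
      module
    · rw [← tOp_apply, h.zero_odd, hv (2 * m + 2) (by omega)]
      push_cast
      module
    · intro i hi hi2 _
      obtain ⟨j, rfl⟩ := heven2 i hi hi2
      rw [← tOp_apply, h.one_even]
      push_cast
      module
    · intro i hi _
      obtain ⟨j, rfl⟩ := hodd i hi
      exact h.one_odd j
    · exact h.one_zero
    · intro i hi _
      obtain ⟨j, rfl⟩ := heven i hi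
      exact h.two_even j
    · intro i hi _
      obtain ⟨j, rfl⟩ := hodd i hi
      rw [← tOp_apply, h.two_odd, sigP, tauP]
      push_cast
      module
    · rw [← tOp_apply, h.two_odd, hv (2 * m + 2) (by omega), sigP, tauP]
      push_cast
      module
    · intro i hi _
      obtain ⟨j, rfl⟩ := heven i hi
      rw [← tOp_apply, h.three_even, sigP, tauP]
      push_cast
      module
    · intro i hi _
      obtain ⟨j, rfl⟩ := hodd i hi
      rw [← tOp_apply, h.three_odd, sigP, tauP]
      push_cast
      module

/-- The characterization of `E_d(a,b,c)` among the `(d+1)`-dimensional irreducible modules. -/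
theorem isEdModule_iff_trace_and_squares [IsAlgClosed F] [CharZero F] {d : ℕ} (hd : Odd d)
    (a b c : F) (hdim : letI := resF F (DAHAAlg F) V; Module.finrank F V = d + 1)
    [IsSimpleModule (DAHAAlg F) V] :
    IsEdModule F a b c d V ↔ (traceOf F (tGen F 0) V = -((d : F) + 1) ∧
      actsAsScalar F (tGen F 1 * tGen F 1) (a ^ 2) V ∧
      actsAsScalar F (tGen F 2 * tGen F 2) (b ^ 2) V ∧
      actsAsScalar F (tGen F 3 * tGen F 3) (c ^ 2) V) := by
  let := resF F (DAHAAlg F) V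
  have := resF_tower F (DAHAAlg F) V rfl
  obtain ⟨m, rfl⟩ := hd
  have hsq : ∀ (i : Fin 4) (k : F), actsAsScalar F (tGen F i * tGen F i) k V ↔
      ∀ u : V, tOp F V i (tOp F V i u) = k • u :=
    fun i k => forall_congr' fun u => by rw [mul_smul]; rfl
  rw [isEdModule_iff_isVermaSeq, hsq, hsq, hsq]
  change _ ↔ LinearMap.trace F V (tOp F V 0) = _ ∧ _
  constructor
  · rintro ⟨B, v, hB, hv, h⟩
    have hext : ∀ (i : Fin 4) (k : F), (∀ n, tOp F V i (tOp F V i (v n)) = k • v n) →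
        ∀ u : V, tOp F V i (tOp F V i u) = k • u := by
      intro i k hk u
      have : tOp F V i ∘ₗ tOp F V i = k • LinearMap.id := B.ext fun j => by
        simpa [hB] using hk j
      exact LinearMap.congr_fun this u
    refine ⟨?_, hext 1 _ h.one_one, hext 2 _ h.two_two, hext 3 _ h.three_three⟩
    rw [h.trace_zero B hB, h.zero_odd, hv (2 * m + 2) (by omega), add_zero, map_smul,
      Finsupp.smul_apply, coord_basis_nat B hB _ (by omega), if_pos (Fin.val_last _).symm]
    push_cast
    rw [smul_eq_mul]
    ring
  · rintro ⟨ht, h1, h2, h3⟩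
    have hdim' : Module.finrank F V = 2 * m + 2 := hdim
    have : FiniteDimensional F V := Module.finite_of_finrank_pos (by omega)
    obtain ⟨k, h0⟩ := exists_tOp_tOp_eq_sq_smul (F := F) (V := V) 0
    refine exists_basis_isVermaSeq eq_bot_or_eq_top_of_forall_tOp_mem hdim' sum_tOp h0 h1 h2 h3 ?_
    rw [ht]
    push_cast
    ring

end Ed

section Twist

variable {F : Type} [Field F]

theorem dahaAut_tGen (π : Equiv.Perm (Fin 4)) (i : Fin 4) :
    dahaAut F π (tGen F i) = tGen F (π i) := by
  simp [dahaAut, tGen]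

theorem dahaAut_surjective (π : Equiv.Perm (Fin 4)) : Function.Surjective (dahaAut F π) := by
  have h : (dahaAut F π).comp (dahaAut F π⁻¹) = AlgHom.id F _ := by
    refine RingQuot.ringQuot_ext' F _ _ (FreeAlgebra.hom_ext (funext fun i => ?_))
    change dahaAut F π (dahaAut F π⁻¹ (tGen F i)) = tGen F i
    rw [dahaAut_tGen, dahaAut_tGen]
    simp
  exact fun x => ⟨dahaAut F π⁻¹ x, DFunLike.congr_fun h x⟩

variable (V : Type) [AddCommGroup V] [Module (DAHAAlg F) V]

theorem resF_twMod (π : Equiv.Perm (Fin 4)) :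
    @resF F _ (DAHAAlg F) _ _ V _ (twMod F π V) = resF F (DAHAAlg F) V := by
  refine Module.ext' _ _ fun r u => ?_
  change dahaAut F π (algebraMap F (DAHAAlg F) r) • u = algebraMap F (DAHAAlg F) r • u
  rw [AlgHom.commutes]

theorem isSimpleModule_twMod [h : IsSimpleModule (DAHAAlg F) V] (π : Equiv.Perm (Fin 4)) :
    @IsSimpleModule (DAHAAlg F) _ V _ (twMod F π V) := by
  have : RingHomSurjective (dahaAut F π).toRingHom := ⟨dahaAut_surjective π⟩
  let l := @LinearMap.mk (DAHAAlg F) (DAHAAlg F) _ _ (dahaAut F π).toRingHom V V _ _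
    (twMod F π V) _ (AddHom.id V) (fun _ _ => rfl)
  exact (@LinearMap.isSimpleModule_iff_of_bijective (DAHAAlg F) (DAHAAlg F) _ _ V _
    (twMod F π V) V _ _ _ _ l Function.bijective_id).2 h

end Twist

/-- Let `d ≥ 1` be odd and `V` a `(d+1)`-dimensional irreducible
`𝔥`-module.  For `a, b, c ∈ F` and `ε ∈ {±1}²` the following are equivalent:
(i) `E_d(a,b,c)^ε ≅ V` (equivalently, `V^ε ≅ E_d(a,b,c)`);
(ii) the trace of `t₀` on `V^ε` is `-(d+1)` and `t₁², t₂², t₃²` act on `V^ε` as scalar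
multiplication by `a², b², c²`. -/
theorem stmt15 (F : Type) [Field F] [IsAlgClosed F] [CharZero F] (d : ℕ) (hd : Odd d) (a b c : F)
    (V : Type) [AddCommGroup V] [Module (DAHAAlg F) V]
    (hdim : letI := resF F (DAHAAlg F) V; Module.finrank F V = d + 1)
    (hirr : IsSimpleModule (DAHAAlg F) V) (ε : ℤˣ × ℤˣ) :
    twIsEdModule F (permOf ε) a b c d V ↔
      (twTrace F (permOf ε) (tGen F 0) V = -((d : F) + 1) ∧
       twActsAsScalar F (permOf ε) (tGen F 1 * tGen F 1) (a ^ 2) V ∧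
       twActsAsScalar F (permOf ε) (tGen F 2 * tGen F 2) (b ^ 2) V ∧
       twActsAsScalar F (permOf ε) (tGen F 3 * tGen F 3) (c ^ 2) V) := by
  have hdim' : letI := @resF F _ (DAHAAlg F) _ _ V _ (twMod F (permOf ε) V)
      Module.finrank F V = d + 1 := by
    rw [resF_twMod]
    exact hdim
  exact @isEdModule_iff_trace_and_squares F _ V _ (twMod F (permOf ε) V) _ _ d hd a b c hdim'
    (isSimpleModule_twMod V _)
end
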